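/- arXiv:2412.19230 — 2 statements merged into one kernel-verified Lean document; each statement's English description precedes it below -/
import Mathlib

section
/- For Δ ≥ 4, the graph C_Δ ∨ I_2 (the join of a Δ-cycle with two independent vertices) is planar, has maximum degree Δ, and its semistrong chromatic index equals 2Δ+4 if Δ ∈ {4,7} and 2Δ+3 otherwise. -/
namespace SSE

open SimpleGraph

variable {V : Type*} {W : Type*}

/-- The set of vertices covered by a set of edges. -/
def cov (M : Set (Sym2 V)) : Set V := {v | ∃ e ∈ M, v ∈ e}

/-- `M` is a matching of `G`: a set of pairwise disjoint edges of `G`. -/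
def IsMatchingSet (G : SimpleGraph V) (M : Set (Sym2 V)) : Prop :=
  M ⊆ G.edgeSet ∧ ∀ e ∈ M, ∀ f ∈ M, e ≠ f → ∀ v : V, v ∈ e → v ∉ f

/-- `v` is a pendant vertex (degree 1) of the subgraph `G_M` of `G` induced by
the vertices covered by `M`. -/
def PendantIn (G : SimpleGraph V) (M : Set (Sym2 V)) (v : V) : Prop :=
  v ∈ cov M ∧ ∃! u, u ∈ cov M ∧ G.Adj v u

/-- `M` is an induced (strong) matching of `G`: every vertex of `G_M` is pendant in `G_M`. -/
def IsInducedMatching (G : SimpleGraph V) (M : Set (Sym2 V)) : Prop :=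
  IsMatchingSet G M ∧ ∀ v ∈ cov M, PendantIn G M v

/-- `M` is a semistrong matching of `G`: every edge of `M` is a pendant edge of `G_M`. -/
def IsSemistrongMatching (G : SimpleGraph V) (M : Set (Sym2 V)) : Prop :=
  IsMatchingSet G M ∧ ∀ e ∈ M, ∃ v, v ∈ e ∧ PendantIn G M v

/-- `N` is a perfect matching of the subgraph of `G` induced by `S`. -/
def IsPerfectMatchingOn (G : SimpleGraph V) (S : Set V) (N : Set (Sym2 V)) : Prop :=
  IsMatchingSet G N ∧ (∀ e ∈ N, ∀ v : V, v ∈ e → v ∈ S) ∧ cov N = S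

/-- `M` is a uniquely restricted matching of `G`: it is the unique perfect matching
of the subgraph induced by the vertices it covers. -/
def IsUniquelyRestrictedMatching (G : SimpleGraph V) (M : Set (Sym2 V)) : Prop :=
  IsMatchingSet G M ∧ ∀ N : Set (Sym2 V), IsPerfectMatchingOn G (cov M) N → N = M

/-- An edge coloring of `G` with colors `< k` each of whose color classes satisfies `P`. -/
def IsPColoring (G : SimpleGraph V) (P : SimpleGraph V → Set (Sym2 V) → Prop)
    (c : Sym2 V → ℕ) (k : ℕ) : Prop :=
  (∀ e ∈ G.edgeSet, c e < k) ∧ ∀ i : ℕ, P G {e | e ∈ G.edgeSet ∧ c e = i}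

/-- The least number of colors in an edge coloring of `G` whose color classes satisfy `P`. -/
noncomputable def pIndex (G : SimpleGraph V)
    (P : SimpleGraph V → Set (Sym2 V) → Prop) : ℕ :=
  sInf {k | ∃ c, IsPColoring G P c k}

/-- The chromatic index. -/
noncomputable def chromIndex (G : SimpleGraph V) : ℕ := pIndex G IsMatchingSet

/-- The uniquely restricted chromatic index. -/
noncomputable def urIndex (G : SimpleGraph V) : ℕ := pIndex G IsUniquelyRestrictedMatching

/-- The semistrong chromatic index. -/
noncomputable def ssIndex (G : SimpleGraph V) : ℕ := pIndex G IsSemistrongMatching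

/-- The strong chromatic index. -/
noncomputable def strongIndex (G : SimpleGraph V) : ℕ := pIndex G IsInducedMatching

/-- The degree of a vertex. -/
noncomputable def natDeg (G : SimpleGraph V) (v : V) : ℕ := (G.neighborSet v).ncard

/-- The maximum average degree of `G` is (strictly) less than `q`:
every nonempty (induced) subgraph has average degree `< q`. -/
def MadLT (G : SimpleGraph V) (q : ℚ) : Prop :=
  ∀ s : Set V, s.Finite → s.Nonempty →
    (2 * ({e ∈ G.edgeSet | ∀ v ∈ e, v ∈ s}.ncard : ℚ)) < q * s.ncard

/-- `K` is a minor of `G` (branch-set formulation). -/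
def HasMinor (G : SimpleGraph V) (K : SimpleGraph W) : Prop :=
  ∃ B : W → Set V, (∀ w, (B w).Nonempty) ∧
    (∀ w, (G.induce (B w)).Connected) ∧
    (Pairwise fun w w' => Disjoint (B w) (B w')) ∧
    (∀ w w', K.Adj w w' → ∃ u ∈ B w, ∃ v ∈ B w', G.Adj u v)

/-- `G` is planar (by Wagner's theorem: no `K₅` minor and no `K₃,₃` minor). -/
def IsPlanar (G : SimpleGraph V) : Prop :=
  ¬ HasMinor G (completeGraph (Fin 5)) ∧
  ¬ HasMinor G (completeBipartiteGraph (Fin 3) (Fin 3))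

/-- The join `C_Δ ∨ I_2` of a cycle on `Δ` vertices with an independent set of 2 vertices. -/
def joinCI (n : ℕ) : SimpleGraph (Fin n ⊕ Fin 2) :=
  SimpleGraph.fromRel (fun x y =>
    match x, y with
    | Sum.inl a, Sum.inl b => (SimpleGraph.cycleGraph n).Adj a b
    | Sum.inl _, Sum.inr _ => True
    | _, _ => False)

/-- `G` contains an `M`-alternating cycle: a cycle whose edges alternate between
edges in `M` and edges not in `M` (cyclically). -/
def HasAlternatingCycle (G : SimpleGraph V) (M : Set (Sym2 V)) : Prop :=
  ∃ (v : V) (c : G.Walk v v), c.IsCycle ∧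
    List.Chain' (fun e f => ¬(e ∈ M ↔ f ∈ M)) c.edges ∧
    ∀ e ∈ c.edges.head?, ∀ f ∈ c.edges.getLast?, ¬(e ∈ M ↔ f ∈ M)

/-- Edges `e` and `f` lie together on a cycle of length 4 in `G`. -/
def OnCommonC4 (G : SimpleGraph V) (e f : Sym2 V) : Prop :=
  ∃ (v : V) (c : G.Walk v v), c.IsCycle ∧ c.length = 4 ∧ e ∈ c.edges ∧ f ∈ c.edges

def sc {n : ℕ} (i : Fin n) : Fin n :=
  ⟨if i.val + 1 < n then i.val + 1 else 0, by have := i.isLt; split <;> omega⟩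

lemma sc_val {n : ℕ} (i : Fin n) : (sc i).val = if i.val + 1 < n then i.val + 1 else 0 := rfl

lemma sc_inj {n : ℕ} {i j : Fin n} (h : sc i = sc j) : i = j := by
  have h1 := congrArg Fin.val h
  have := i.isLt
  have := j.isLt
  rw [sc_val, sc_val] at h1
  apply Fin.ext
  split_ifs at h1 <;> omega

lemma sc_surj {n : ℕ} (i : Fin n) : ∃ j, sc j = i := by
  have := i.isLt
  by_cases h : i.val = 0
  · refine ⟨⟨n - 1, by omega⟩, Fin.ext ?_⟩
    rw [sc_val]
    dsimp only
    split_ifs <;> omega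
  · refine ⟨⟨i.val - 1, by omega⟩, Fin.ext ?_⟩
    rw [sc_val]
    dsimp only
    split_ifs <;> omega

lemma sc_ne {n : ℕ} (hn : 4 ≤ n) (i : Fin n) :
    sc i ≠ i ∧ sc (sc i) ≠ i ∧ sc (sc (sc i)) ≠ i := by
  have := i.isLt
  simp only [ne_eq, Fin.ext_iff, sc_val]
  refine ⟨?_, ?_, ?_⟩ <;> split_ifs <;> omega

lemma cyc_adj {n : ℕ} (hn : 4 ≤ n) (i j : Fin n) :
    (cycleGraph n).Adj i j ↔ (j = sc i ∨ i = sc j) := by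
  have := i.isLt
  have := j.isLt
  have hij : i = j ↔ i.val = j.val := Fin.ext_iff
  rw [cycleGraph_adj']
  simp only [Fin.ext_iff, sc_val, Fin.sub_def]
  rcases lt_trichotomy i.val j.val with h | h | h
  · rw [show n - j.val + i.val = n - (j.val - i.val) by omega, Nat.mod_eq_of_lt (by omega),
      show n - i.val + j.val = (j.val - i.val) + n by omega, Nat.add_mod_right,
      Nat.mod_eq_of_lt (by omega)]
    split_ifs <;> omega
  · obtain rfl := hij.2 h
    have h0 : (n - i.val + i.val) % n = 0 := by
      rw [show n - i.val + i.val = n by omega, Nat.mod_self]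
    rw [h0]
    constructor
    · rintro (h | h) <;> omega
    · rintro (h | h) <;> split_ifs at h <;> omega
  · rw [show n - i.val + j.val = n - (i.val - j.val) by omega,
      Nat.mod_eq_of_lt (show n - (i.val - j.val) < n by omega),
      show n - j.val + i.val = (i.val - j.val) + n by omega, Nat.add_mod_right,
      Nat.mod_eq_of_lt (show i.val - j.val < n by omega)]
    split_ifs <;> omega

lemma adj_ll {n : ℕ} (hn : 4 ≤ n) (i j : Fin n) :
    (joinCI n).Adj (Sum.inl i) (Sum.inl j) ↔ (j = sc i ∨ i = sc j) := by
  have h1 := (sc_ne hn i).1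
  have h2 := (sc_ne hn j).1
  simp only [joinCI, fromRel_adj, cyc_adj hn]
  grind

lemma adj_lr {n : ℕ} (i : Fin n) (k : Fin 2) :
    (joinCI n).Adj (Sum.inl i) (Sum.inr k) := by
  simp [joinCI, fromRel_adj]

lemma adj_rl {n : ℕ} (i : Fin n) (k : Fin 2) :
    (joinCI n).Adj (Sum.inr k) (Sum.inl i) := by
  simp [joinCI, fromRel_adj]

lemma adj_rr {n : ℕ} (k l : Fin 2) :
    ¬ (joinCI n).Adj (Sum.inr k) (Sum.inr l) := by
  simp [joinCI, fromRel_adj]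

/-! ### Degrees -/

lemma natDeg_r {n : ℕ} (k : Fin 2) : natDeg (joinCI n) (Sum.inr k) = n := by
  have : (joinCI n).neighborSet (Sum.inr k) = Set.range (Sum.inl : Fin n → Fin n ⊕ Fin 2) := by
    ext x
    rcases x with i | l
    · simp [adj_rl]
    · simp [adj_rr]
  rw [natDeg, this, ← Set.image_univ, Set.ncard_image_of_injective _ Sum.inl_injective]
  simp

lemma natDeg_l {n : ℕ} (hn : 4 ≤ n) (i : Fin n) : natDeg (joinCI n) (Sum.inl i) ≤ n := by
  obtain ⟨p, hp⟩ := sc_surj i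
  have : (joinCI n).neighborSet (Sum.inl i) ⊆
      (({Sum.inl (sc i), Sum.inl p, Sum.inr 0, Sum.inr 1} : Finset (Fin n ⊕ Fin 2)) : Set _) := by
    intro x hx
    rw [mem_neighborSet] at hx
    rcases x with j | l
    · rw [adj_ll hn] at hx
      rcases hx with h | h
      · simp [h]
      · have : p = j := sc_inj (hp.trans h)
        simp [this]
    · fin_cases l <;> simp
  refine le_trans (Set.ncard_le_ncard this (Finset.finite_toSet _)) ?_
  rw [Set.ncard_coe_finset]
  exact le_trans Finset.card_le_four hn

/-! ### Planarity -/

/-- A branch set consisting of rim vertices only. -/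
def HubFree {n : ℕ} (S : Set (Fin n ⊕ Fin 2)) : Prop := ∀ k, Sum.inr k ∉ S

lemma conn_closed {n : ℕ} {S : Set (Fin n ⊕ Fin 2)} (hc : ((joinCI n).induce S).Connected)
    (T : Set (Fin n ⊕ Fin 2))
    (hT : ∀ x ∈ S, ∀ y ∈ S, (joinCI n).Adj x y → x ∈ T → y ∈ T)
    {x y : Fin n ⊕ Fin 2} (hx : x ∈ S) (hy : y ∈ S) (hxT : x ∈ T) : y ∈ T := by
  have h := hc.preconnected ⟨x, hx⟩ ⟨y, hy⟩
  rw [reachable_iff_reflTransGen] at h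
  have key : ∀ z : S, Relation.ReflTransGen ((joinCI n).induce S).Adj ⟨x, hx⟩ z → z.1 ∈ T := by
    intro z hz
    induction hz with
    | refl => exact hxT
    | tail _ h2 ih => exact hT _ (Subtype.prop _) _ (Subtype.prop _) h2 ih
  exact key _ h

lemma exit_lt {n : ℕ} (hn : 4 ≤ n) {S : Set (Fin n ⊕ Fin 2)} (hp : HubFree S)
    (hc : ((joinCI n).induce S).Connected) {i j : Fin n}
    (hi : Sum.inl i ∈ S) (hi' : Sum.inl (sc i) ∉ S)
    (hj : Sum.inl j ∈ S) (hj' : Sum.inl (sc j) ∉ S) : ¬ i.val < j.val := by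
  intro hij
  have := conn_closed hc {x | ∃ m : Fin n, x = Sum.inl m ∧ i.val < m.val ∧ m.val ≤ j.val}
    (by
      rintro x hx y hy hxy ⟨m, rfl, h1, h2⟩
      rcases y with y | y
      · refine ⟨y, rfl, ?_⟩
        rw [adj_ll hn] at hxy
        have hmj : y = sc m → m.val ≠ j.val := by
          rintro rfl h
          rw [Fin.ext h] at hy
          exact hj' hy
        have hmi : m.val ≠ (sc i).val := by
          intro h
          rw [Fin.ext h] at hx
          exact hi' hx
        rw [sc_val] at hmi
        have := j.isLt
        have := y.isLt
        rcases hxy with h | h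
        · have h3 := hmj h
          have h4 := congrArg Fin.val h
          rw [sc_val] at h4
          split_ifs at h4 hmi <;> omega
        · have h4 := congrArg Fin.val h
          rw [sc_val] at h4
          split_ifs at h4 hmi <;> omega
      · exact absurd hy (hp y)) hj hi ⟨j, rfl, hij, le_rfl⟩
  obtain ⟨m, hm, h1, -⟩ := this
  rw [Sum.inl.inj hm] at h1
  omega

lemma enter_lt {n : ℕ} (hn : 4 ≤ n) {S : Set (Fin n ⊕ Fin 2)} (hp : HubFree S)
    (hc : ((joinCI n).induce S).Connected) {i j : Fin n}
    (hi : Sum.inl (sc i) ∈ S) (hi' : Sum.inl i ∉ S)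
    (hj : Sum.inl (sc j) ∈ S) (hj' : Sum.inl j ∉ S) : ¬ (sc i).val < (sc j).val := by
  intro hij
  have := conn_closed hc
    {x | ∃ m : Fin n, x = Sum.inl m ∧ (sc i).val ≤ m.val ∧ m.val < (sc j).val}
    (by
      rintro x hx y hy hxy ⟨m, rfl, h1, h2⟩
      rcases y with y | y
      · refine ⟨y, rfl, ?_⟩
        rw [adj_ll hn] at hxy
        have hmj : m.val ≠ j.val := by
          intro h
          rw [Fin.ext h] at hx
          exact hj' hx
        have hmi : y.val ≠ i.val := by
          intro h
          rw [Fin.ext h] at hy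
          exact hi' hy
        have := j.isLt
        have := i.isLt
        have := y.isLt
        simp only [sc_val] at h1 h2 hij
        simp only [Fin.ext_iff, sc_val] at hxy ⊢
        split_ifs at * <;> omega
      · exact absurd hy (hp y)) hi hj ⟨sc i, rfl, le_rfl, hij⟩
  obtain ⟨m, hm, -, h1⟩ := this
  rw [Sum.inl.inj hm] at h1
  omega

lemma exit_unique {n : ℕ} (hn : 4 ≤ n) {S : Set (Fin n ⊕ Fin 2)} (hp : HubFree S)
    (hc : ((joinCI n).induce S).Connected) {i j : Fin n}
    (hi : Sum.inl i ∈ S) (hi' : Sum.inl (sc i) ∉ S)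
    (hj : Sum.inl j ∈ S) (hj' : Sum.inl (sc j) ∉ S) : i = j := by
  have h1 := exit_lt hn hp hc hi hi' hj hj'
  have h2 := exit_lt hn hp hc hj hj' hi hi'
  exact Fin.ext (by omega)

lemma enter_unique {n : ℕ} (hn : 4 ≤ n) {S : Set (Fin n ⊕ Fin 2)} (hp : HubFree S)
    (hc : ((joinCI n).induce S).Connected) {i j : Fin n}
    (hi : Sum.inl (sc i) ∈ S) (hi' : Sum.inl i ∉ S)
    (hj : Sum.inl (sc j) ∈ S) (hj' : Sum.inl j ∉ S) : i = j := by
  have h1 := enter_lt hn hp hc hi hi' hj hj'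
  have h2 := enter_lt hn hp hc hj hj' hi hi'
  exact sc_inj (Fin.ext (by omega))

/-- Some rim edge leads clockwise from `S` to `T`. -/
def To {n : ℕ} (S T : Set (Fin n ⊕ Fin 2)) : Prop :=
  ∃ i : Fin n, Sum.inl i ∈ S ∧ Sum.inl (sc i) ∈ T

lemma to_or_to {n : ℕ} (hn : 4 ≤ n) {S T : Set (Fin n ⊕ Fin 2)} (hS : HubFree S) (hT : HubFree T)
    (h : ∃ u ∈ S, ∃ v ∈ T, (joinCI n).Adj u v) : To S T ∨ To T S := by
  obtain ⟨u, hu, v, hv, huv⟩ := h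
  rcases u with i | k
  · rcases v with j | l
    · rw [adj_ll hn] at huv
      rcases huv with rfl | rfl
      · exact Or.inl ⟨i, hu, hv⟩
      · exact Or.inr ⟨j, hv, hu⟩
    · exact absurd hv (hT l)
  · exact absurd hu (hS k)

lemma cover_of_closed {n : ℕ} {S : Set (Fin n ⊕ Fin 2)} (hne : ∃ i : Fin n, Sum.inl i ∈ S)
    (h : ∀ i : Fin n, Sum.inl i ∈ S → Sum.inl (sc i) ∈ S) (j : Fin n) : Sum.inl j ∈ S := by
  obtain ⟨i, hi⟩ := hne
  have hup : ∀ a : Fin n, Sum.inl a ∈ S → ∀ d : ℕ, ∀ b : Fin n, b.val = a.val + d →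
      Sum.inl b ∈ S := by
    intro a ha d
    induction d with
    | zero =>
      intro b hb
      rwa [show b = a from Fin.ext (by omega)]
    | succ d ih =>
      intro b hb
      have := b.isLt
      have h1 := h _ (ih ⟨a.val + d, by omega⟩ rfl)
      rwa [show sc (⟨a.val + d, by omega⟩ : Fin n) = b from Fin.ext (by
        rw [sc_val]; dsimp only; split_ifs <;> omega)] at h1
  have hi2 := i.isLt
  have hl : Sum.inl (⟨n - 1, by omega⟩ : Fin n) ∈ S := hup i hi (n - 1 - i.val) _ (by
    dsimp only; omega)
  have h0 := h _ hl
  exact hup _ h0 j.val j (by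
    rw [sc_val]; dsimp only; split_ifs <;> omega)

section minor
variable {n : ℕ} {X : Type*} {K : SimpleGraph X} {B : X → Set (Fin n ⊕ Fin 2)}

lemma mem_uniq (hd : Pairwise fun w w' => Disjoint (B w) (B w')) {v w w'} (h : v ∈ B w)
    (h' : v ∈ B w') : w = w' := by
  by_contra hne
  exact Set.disjoint_left.mp (hd hne) h h'

lemma to_right (hn : 4 ≤ n) (hc : ∀ w, ((joinCI n).induce (B w)).Connected)
    (hd : Pairwise fun w w' => Disjoint (B w) (B w')) {w x : X} (hw : HubFree (B w))
    (hne : w ≠ x) (hx : To (B w) (B x)) {i : Fin n} (hi : Sum.inl i ∈ B w) :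
    Sum.inl (sc i) ∈ B w ∨ Sum.inl (sc i) ∈ B x := by
  by_cases h : Sum.inl (sc i) ∈ B w
  · exact Or.inl h
  · right
    obtain ⟨j, hj, hj'⟩ := hx
    have := exit_unique hn hw (hc w) hi h hj (fun h2 => hne (mem_uniq hd h2 hj'))
    rwa [this]

lemma to_uniq (hn : 4 ≤ n) (hc : ∀ w, ((joinCI n).induce (B w)).Connected)
    (hd : Pairwise fun w w' => Disjoint (B w) (B w')) {w x y : X} (hw : HubFree (B w))
    (hwx : w ≠ x) (hwy : w ≠ y) (hx : To (B w) (B x)) (hy : To (B w) (B y)) : x = y := by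
  obtain ⟨j, hj, hj'⟩ := hy
  rcases to_right hn hc hd hw hwx hx hj with h | h
  · exact absurd (mem_uniq hd h hj') hwy
  · exact mem_uniq hd h hj'

lemma from_uniq (hn : 4 ≤ n) (hc : ∀ w, ((joinCI n).induce (B w)).Connected)
    (hd : Pairwise fun w w' => Disjoint (B w) (B w')) {w x y : X} (hw : HubFree (B w))
    (hwx : w ≠ x) (hwy : w ≠ y) (hx : To (B x) (B w)) (hy : To (B y) (B w)) : x = y := by
  obtain ⟨j, hj, hj'⟩ := hy
  obtain ⟨i, hi, hi'⟩ := hx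
  have := enter_unique hn hw (hc w) hi' (fun h => hwx (mem_uniq hd h hi)) hj'
    (fun h => hwy (mem_uniq hd h hj))
  subst this
  exact mem_uniq hd hi hj

/-- A set of pure branch sets closed under clockwise succession leaves only hubs to the others. -/
lemma no_rest (hn : 4 ≤ n) (hc : ∀ w, ((joinCI n).induce (B w)).Connected)
    (hd : Pairwise fun w w' => Disjoint (B w) (B w')) (P : Set X)
    (hP : ∀ w ∈ P, HubFree (B w) ∧ ∃ x ∈ P, w ≠ x ∧ To (B w) (B x)) (hPn : P.Nonempty)
    {s t : X} (hs : s ∉ P) (ht : t ∉ P)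
    (hst : ∃ u ∈ B s, ∃ v ∈ B t, (joinCI n).Adj u v) : False := by
  have hcov : ∀ j : Fin n, Sum.inl j ∈ ⋃ w ∈ P, B w := by
    apply cover_of_closed
    · obtain ⟨w, hw⟩ := hPn
      obtain ⟨-, x, hx, -, i, hi, -⟩ := hP w hw
      exact ⟨i, Set.mem_biUnion hw hi⟩
    · intro i hi
      simp only [Set.mem_iUnion] at hi ⊢
      obtain ⟨w, hw, hi⟩ := hi
      obtain ⟨h1, x, hx, hwx, h2⟩ := hP w hw
      rcases to_right hn hc hd h1 hwx h2 hi with h | h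
      · exact ⟨w, hw, h⟩
      · exact ⟨x, hx, h⟩
  simp only [Set.mem_iUnion] at hcov
  obtain ⟨u, hu, v, hv, huv⟩ := hst
  rcases u with i | k
  · obtain ⟨w, hw, h⟩ := hcov i
    exact hs (mem_uniq hd h hu ▸ hw)
  · rcases v with j | l
    · obtain ⟨w, hw, h⟩ := hcov j
      exact ht (mem_uniq hd h hv ▸ hw)
    · exact adj_rr _ _ huv

lemma exists_pq [Nonempty X] (hd : Pairwise fun w w' => Disjoint (B w) (B w')) :
    ∃ p q : X, ∀ w, w ≠ p → w ≠ q → HubFree (B w) := by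
  classical
  have h : ∀ k : Fin 2, ∃ p : X, ∀ w, Sum.inr k ∈ B w → w = p := by
    intro k
    by_cases hk : ∃ p, Sum.inr k ∈ B p
    · obtain ⟨p, hp⟩ := hk
      exact ⟨p, fun w hw => mem_uniq hd hw hp⟩
    · push Not at hk
      exact ⟨Classical.arbitrary X, fun w hw => absurd hw (hk w)⟩
  obtain ⟨p, hp⟩ := h 0
  obtain ⟨q, hq⟩ := h 1
  refine ⟨p, q, fun w h1 h2 k hk => ?_⟩
  fin_cases k
  · exact h1 (hp w hk)
  · exact h2 (hq w hk)

end minor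

lemma fin5 : ∀ p q : Fin 5, ∃ x y z s t : Fin 5, (x ≠ p ∧ x ≠ q) ∧ (y ≠ p ∧ y ≠ q) ∧
    (z ≠ p ∧ z ≠ q) ∧ x ≠ y ∧ y ≠ z ∧ z ≠ x ∧ s ≠ t ∧ s ≠ x ∧ s ≠ y ∧ s ≠ z ∧
    t ≠ x ∧ t ≠ y ∧ t ≠ z := by
  have h : ∀ p q : Fin 5, ∃ x : Fin 5, (x ≠ p ∧ x ≠ q) ∧ ∃ y : Fin 5, (y ≠ p ∧ y ≠ q) ∧ x ≠ y ∧
    ∃ z : Fin 5, (z ≠ p ∧ z ≠ q) ∧ y ≠ z ∧ z ≠ x ∧ ∃ s : Fin 5, s ≠ x ∧ s ≠ y ∧ s ≠ z ∧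
    ∃ t : Fin 5, s ≠ t ∧ t ≠ x ∧ t ≠ y ∧ t ≠ z := by decide
  intro p q
  obtain ⟨x, hx, y, hy, hxy, z, hz, hyz, hzx, s, h1, h2, h3, t, h4, h5, h6, h7⟩ := h p q
  exact ⟨x, y, z, s, t, hx, hy, hz, hxy, hyz, hzx, h4, h1, h2, h3, h5, h6, h7⟩

lemma fin3 : ∀ p : Fin 3, ∃ x y : Fin 3, x ≠ p ∧ y ≠ p ∧ x ≠ y := by decide
lemma fin3' : ∀ p q : Fin 3, ∃ x : Fin 3, x ≠ p ∧ x ≠ q := by decide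

lemma no_K5 {n : ℕ} (hn : 4 ≤ n) : ¬ HasMinor (joinCI n) (completeGraph (Fin 5)) := by
  rintro ⟨B, -, hc, hd, hK⟩
  obtain ⟨p, q, hpq⟩ := exists_pq hd
  obtain ⟨x, y, z, s, t, hx, hy, hz, hxy, hyz, hzx, h1, h2, h3, h4, h5, h6, h7⟩ := fin5 p q
  have px := hpq x hx.1 hx.2
  have py := hpq y hy.1 hy.2
  have pz := hpq z hz.1 hz.2
  have a1 := to_or_to hn px py (hK x y hxy)
  have a2 := to_or_to hn py pz (hK y z hyz)
  have a3 := to_or_to hn pz px (hK z x hzx)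
  have ux : To (B x) (B y) → To (B x) (B z) → False := fun h h' =>
    hyz (to_uniq hn hc hd px hxy hzx.symm h h')
  have uy : To (B y) (B x) → To (B y) (B z) → False := fun h h' =>
    hzx.symm (to_uniq hn hc hd py hxy.symm hyz h h')
  have uz : To (B z) (B x) → To (B z) (B y) → False := fun h h' =>
    hxy (to_uniq hn hc hd pz hzx hyz.symm h h')
  refine no_rest hn hc hd {x, y, z} ?_ ⟨x, by simp⟩ (s := s) (t := t) (by simp [h2, h3, h4])
    (by simp [h5, h6, h7]) (hK s t h1)
  have hxz := hzx.symm
  have hyx := hxy.symm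
  have hzy := hyz.symm
  have key : (To (B x) (B y) ∧ To (B y) (B z) ∧ To (B z) (B x)) ∨
    (To (B y) (B x) ∧ To (B z) (B y) ∧ To (B x) (B z)) := by tauto
  simp only [Set.mem_insert_iff, Set.mem_singleton_iff]
  rcases key with ⟨k1, k2, k3⟩ | ⟨k1, k2, k3⟩
  · rintro w (rfl | rfl | rfl)
    · exact ⟨px, y, by simp, hxy, k1⟩
    · exact ⟨py, z, by simp, hyz, k2⟩
    · exact ⟨pz, x, by simp, hzx, k3⟩
  · rintro w (rfl | rfl | rfl)
    · exact ⟨px, z, by simp, hxz, k3⟩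
    · exact ⟨py, x, by simp, hyx, k1⟩
    · exact ⟨pz, y, by simp, hzy, k2⟩

section K33
variable {n : ℕ} {X : Type*} {B : X → Set (Fin n ⊕ Fin 2)}

lemma no_star (hn : 4 ≤ n) (hc : ∀ w, ((joinCI n).induce (B w)).Connected)
    (hd : Pairwise fun w w' => Disjoint (B w) (B w')) {y : X} (f : Fin 3 → X)
    (hf : Function.Injective f) (hy : HubFree (B y)) (hyf : ∀ i, y ≠ f i) (hp : ∀ i, HubFree (B (f i)))
    (hadj : ∀ i, ∃ u ∈ B y, ∃ v ∈ B (f i), (joinCI n).Adj u v) : False := by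
  have a := fun i => to_or_to hn hy (hp i) (hadj i)
  have b : ∀ i j, i ≠ j → To (B y) (B (f i)) → To (B y) (B (f j)) → False := fun i j hij h h' =>
    hij (hf (to_uniq hn hc hd hy (hyf i) (hyf j) h h'))
  have c : ∀ i j, i ≠ j → To (B (f i)) (B y) → To (B (f j)) (B y) → False := fun i j hij h h' =>
    hij (hf (from_uniq hn hc hd hy (hyf i) (hyf j) h h'))
  have := a 0
  have := a 1
  have := a 2
  have := b 0 1 (by decide)
  have := b 0 2 (by decide)
  have := b 1 2 (by decide)
  have := c 0 1 (by decide)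
  have := c 0 2 (by decide)
  have := c 1 2 (by decide)
  tauto

lemma no_square (hn : 4 ≤ n) (hc : ∀ w, ((joinCI n).induce (B w)).Connected)
    (hd : Pairwise fun w w' => Disjoint (B w) (B w')) {x x' y y' s t : X}
    (px : HubFree (B x)) (px' : HubFree (B x')) (py : HubFree (B y)) (py' : HubFree (B y'))
    (hxx : x ≠ x') (hyy : y ≠ y') (h1 : x ≠ y) (h2 : x ≠ y') (h3 : x' ≠ y) (h4 : x' ≠ y')
    (hs : s ∉ ({x, x', y, y'} : Set X)) (ht : t ∉ ({x, x', y, y'} : Set X))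
    (a1 : ∃ u ∈ B x, ∃ v ∈ B y, (joinCI n).Adj u v)
    (a2 : ∃ u ∈ B x, ∃ v ∈ B y', (joinCI n).Adj u v)
    (a3 : ∃ u ∈ B x', ∃ v ∈ B y, (joinCI n).Adj u v)
    (a4 : ∃ u ∈ B x', ∃ v ∈ B y', (joinCI n).Adj u v)
    (a5 : ∃ u ∈ B s, ∃ v ∈ B t, (joinCI n).Adj u v) : False := by
  replace a1 := to_or_to hn px py a1
  replace a2 := to_or_to hn px py' a2
  replace a3 := to_or_to hn px' py a3
  replace a4 := to_or_to hn px' py' a4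
  have u1 : To (B x) (B y) → To (B x) (B y') → False := fun h h' =>
    hyy (to_uniq hn hc hd px h1 h2 h h')
  have u2 : To (B x') (B y) → To (B x') (B y') → False := fun h h' =>
    hyy (to_uniq hn hc hd px' h3 h4 h h')
  have u3 : To (B y) (B x) → To (B y) (B x') → False := fun h h' =>
    hxx (to_uniq hn hc hd py h1.symm h3.symm h h')
  have u4 : To (B y') (B x) → To (B y') (B x') → False := fun h h' =>
    hxx (to_uniq hn hc hd py' h2.symm h4.symm h h')
  have key : (To (B x) (B y) ∧ To (B y) (B x') ∧ To (B x') (B y') ∧ To (B y') (B x)) ∨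
    (To (B y) (B x) ∧ To (B x') (B y) ∧ To (B y') (B x') ∧ To (B x) (B y')) := by tauto
  refine no_rest hn hc hd {x, x', y, y'} ?_ ⟨x, by simp⟩ hs ht a5
  simp only [Set.mem_insert_iff, Set.mem_singleton_iff]
  have h1' := h1.symm
  have h2' := h2.symm
  have h3' := h3.symm
  have h4' := h4.symm
  rcases key with ⟨k1, k2, k3, k4⟩ | ⟨k1, k2, k3, k4⟩
  · rintro w (rfl | rfl | rfl | rfl)
    · exact ⟨px, y, by simp, h1, k1⟩
    · exact ⟨px', y', by simp, h4, k3⟩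
    · exact ⟨py, x', by simp, h3', k2⟩
    · exact ⟨py', x, by simp, h2', k4⟩
  · rintro w (rfl | rfl | rfl | rfl)
    · exact ⟨px, y', by simp, h2, k4⟩
    · exact ⟨px', y, by simp, h3, k2⟩
    · exact ⟨py, x, by simp, h1', k1⟩
    · exact ⟨py', x', by simp, h4', k3⟩

end K33

lemma no_K33 {n : ℕ} (hn : 4 ≤ n) :
    ¬ HasMinor (joinCI n) (completeBipartiteGraph (Fin 3) (Fin 3)) := by
  rintro ⟨B, -, hc, hd, hK⟩
  obtain ⟨p, q, hpq⟩ := exists_pq hd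
  have lr : ∀ i j : Fin 3, ∃ u ∈ B (Sum.inl i), ∃ v ∈ B (Sum.inr j), (joinCI n).Adj u v :=
    fun i j => hK _ _ (by simp)
  have rl : ∀ i j : Fin 3, ∃ u ∈ B (Sum.inr i), ∃ v ∈ B (Sum.inl j), (joinCI n).Adj u v :=
    fun i j => hK _ _ (by simp)
  have mixed : ∀ p q : Fin 3, (∀ w, w ≠ Sum.inl p → w ≠ Sum.inr q → HubFree (B w)) → False := by
    intro p q h
    obtain ⟨x, x', hx, hx', hxx⟩ := fin3 p
    obtain ⟨y, y', hy, hy', hyy⟩ := fin3 q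
    exact no_square hn hc hd (x := Sum.inl x) (x' := Sum.inl x') (y := Sum.inr y)
      (y' := Sum.inr y') (s := Sum.inl p) (t := Sum.inr q)
      (h _ (by simpa) (by simp)) (h _ (by simpa) (by simp))
      (h _ (by simp) (by simpa)) (h _ (by simp) (by simpa)) (by simpa) (by simpa)
      (by simp) (by simp) (by simp) (by simp) (by simp [hx.symm, hx'.symm])
      (by simp [hy.symm, hy'.symm])
      (lr _ _) (lr _ _) (lr _ _) (lr _ _) (lr _ _)
  rcases p with p | p <;> rcases q with q | q
  · obtain ⟨x, h1, h2⟩ := fin3' p q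
    exact no_star hn hc hd (y := Sum.inl x) Sum.inr Sum.inr_injective
      (hpq _ (by simpa) (by simpa)) (by simp) (fun i => hpq _ (by simp) (by simp)) (fun i => lr _ _)
  · exact mixed p q hpq
  · exact mixed q p (fun w h1 h2 => hpq w h2 h1)
  · obtain ⟨x, h1, h2⟩ := fin3' p q
    exact no_star hn hc hd (y := Sum.inr x) Sum.inl Sum.inl_injective
      (hpq _ (by simpa) (by simpa)) (by simp) (fun i => hpq _ (by simp) (by simp)) (fun i => rl _ _)

/-! ### Semistrong chromatic index -/

/-- Rim edge. -/
def rimE {n : ℕ} (i : Fin n) : Sym2 (Fin n ⊕ Fin 2) := s(Sum.inl i, Sum.inl (sc i))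

/-- Spoke. -/
def spoke {n : ℕ} (p : Fin n × Fin 2) : Sym2 (Fin n ⊕ Fin 2) := s(Sum.inl p.1, Sum.inr p.2)

lemma rimE_mem {n : ℕ} (hn : 4 ≤ n) (i : Fin n) : rimE i ∈ (joinCI n).edgeSet := by
  rw [rimE, mem_edgeSet, adj_ll hn]
  exact Or.inl rfl

lemma spoke_mem {n : ℕ} (p : Fin n × Fin 2) : spoke p ∈ (joinCI n).edgeSet := by
  rw [spoke, mem_edgeSet]
  exact adj_lr _ _

lemma edge_cases {n : ℕ} (hn : 4 ≤ n) {e : Sym2 (Fin n ⊕ Fin 2)} (he : e ∈ (joinCI n).edgeSet) :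
    (∃ i, e = rimE i) ∨ ∃ p, e = spoke p := by
  induction e using Sym2.ind with
  | _ x y =>
    rw [mem_edgeSet] at he
    rcases x with i | k <;> rcases y with j | l
    · rw [adj_ll hn] at he
      rcases he with rfl | rfl
      · exact Or.inl ⟨i, rfl⟩
      · exact Or.inl ⟨j, Sym2.eq_swap⟩
    · exact Or.inr ⟨(i, l), rfl⟩
    · exact Or.inr ⟨(j, k), Sym2.eq_swap⟩
    · exact absurd he (adj_rr _ _)

lemma rimE_inj {n : ℕ} (hn : 4 ≤ n) {i j : Fin n} (h : rimE i = rimE j) : i = j := by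
  simp only [rimE, Sym2.eq_iff, Sum.inl.injEq] at h
  rcases h with h | ⟨h, h'⟩
  · exact h.1
  · subst h
    exact absurd h' (sc_ne hn j).2.1

lemma spoke_inj {n : ℕ} {p q : Fin n × Fin 2} (h : spoke p = spoke q) : p = q := by
  simp only [spoke, Sym2.eq_iff] at h
  rcases h with ⟨h, h'⟩ | ⟨h, -⟩
  · exact Prod.ext (Sum.inl.inj h) (Sum.inr.inj h')
  · cases h

lemma rimE_ne_spoke {n : ℕ} {i : Fin n} {p : Fin n × Fin 2} : rimE i ≠ spoke p := by
  simp [rimE, spoke]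

lemma not_pendant {G : SimpleGraph V} {M : Set (Sym2 V)} {v x y : V} (hx : x ∈ cov M)
    (hy : y ∈ cov M) (hxy : x ≠ y) (hvx : G.Adj v x) (hvy : G.Adj v y) : ¬ PendantIn G M v := by
  rintro ⟨-, u, -, hu⟩
  exact hxy ((hu x ⟨hx, hvx⟩).trans (hu y ⟨hy, hvy⟩).symm)

lemma spoke_single {n : ℕ} (hn : 4 ≤ n) {M : Set (Sym2 (Fin n ⊕ Fin 2))}
    (hM : IsSemistrongMatching (joinCI n) M) {p : Fin n × Fin 2} (hp : spoke p ∈ M)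
    {f : Sym2 (Fin n ⊕ Fin 2)} (hf : f ∈ M) : f = spoke p := by
  by_contra hne
  obtain ⟨⟨hE, hdis⟩, hpen⟩ := hM
  have c1 : Sum.inl p.1 ∈ cov M := ⟨_, hp, by simp [spoke]⟩
  have c2 : Sum.inr p.2 ∈ cov M := ⟨_, hp, by simp [spoke]⟩
  rcases edge_cases hn (hE hf) with ⟨i, rfl⟩ | ⟨q, rfl⟩
  · have d1 : Sum.inl i ∈ cov M := ⟨_, hf, by simp [rimE]⟩
    have d2 : Sum.inl (sc i) ∈ cov M := ⟨_, hf, by simp [rimE]⟩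
    obtain ⟨v, hv, hvp⟩ := hpen _ hf
    simp only [rimE, Sym2.mem_iff] at hv
    rcases hv with rfl | rfl
    · exact not_pendant d2 c2 (by simp) ((adj_ll hn _ _).2 (Or.inl rfl)) (adj_lr _ _) hvp
    · exact not_pendant d1 c2 (by simp) ((adj_ll hn _ _).2 (Or.inr rfl)) (adj_lr _ _) hvp
  · have d1 : Sum.inl q.1 ∈ cov M := ⟨_, hf, by simp [spoke]⟩
    have d2 : Sum.inr q.2 ∈ cov M := ⟨_, hf, by simp [spoke]⟩
    have n1 : p.1 ≠ q.1 := fun h => hdis _ hf _ hp hne (Sum.inl q.1) (by simp [spoke])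
      (by simp [spoke, h])
    have n2 : p.2 ≠ q.2 := fun h => hdis _ hf _ hp hne (Sum.inr q.2) (by simp [spoke])
      (by simp [spoke, h])
    obtain ⟨v, hv, hvp⟩ := hpen _ hf
    simp only [spoke, Sym2.mem_iff] at hv
    rcases hv with rfl | rfl
    · exact not_pendant c2 d2 (by simpa using n2) (adj_lr _ _) (adj_lr _ _) hvp
    · exact not_pendant c1 d1 (by simpa using n1) (adj_rl _ _) (adj_rl _ _) hvp

lemma rim_two {n : ℕ} (hn : 4 ≤ n) {M : Set (Sym2 (Fin n ⊕ Fin 2))}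
    (hM : IsSemistrongMatching (joinCI n) M) {i : Fin n} (h1 : rimE i ∈ M)
    (h2 : rimE (sc i) ∈ M) : False := by
  refine hM.1.2 _ h1 _ h2 (fun h => (sc_ne hn i).1 (rimE_inj hn h).symm) (Sum.inl (sc i))
    (by simp [rimE]) (by simp [rimE])

lemma rim_three {n : ℕ} (hn : 4 ≤ n) {M : Set (Sym2 (Fin n ⊕ Fin 2))}
    (hM : IsSemistrongMatching (joinCI n) M) {i : Fin n} (h1 : rimE i ∈ M)
    (h2 : rimE (sc (sc i)) ∈ M) (h3 : rimE (sc (sc (sc (sc i)))) ∈ M) : False := by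
  have c1 : Sum.inl (sc i) ∈ cov M := ⟨_, h1, by simp [rimE]⟩
  have c2 : Sum.inl (sc (sc i)) ∈ cov M := ⟨_, h2, by simp [rimE]⟩
  have c3 : Sum.inl (sc (sc (sc i))) ∈ cov M := ⟨_, h2, by simp [rimE]⟩
  have c4 : Sum.inl (sc (sc (sc (sc i)))) ∈ cov M := ⟨_, h3, by simp [rimE]⟩
  obtain ⟨v, hv, hvp⟩ := hM.2 _ h2
  simp only [rimE, Sym2.mem_iff] at hv
  rcases hv with rfl | rfl
  · exact not_pendant c1 c3 (by simpa using (sc_ne hn (sc i)).2.1.symm)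
      ((adj_ll hn _ _).2 (Or.inr rfl)) ((adj_ll hn _ _).2 (Or.inl rfl)) hvp
  · exact not_pendant c2 c4 (by simpa using (sc_ne hn (sc (sc i))).2.1.symm)
      ((adj_ll hn _ _).2 (Or.inr rfl)) ((adj_ll hn _ _).2 (Or.inl rfl)) hvp

/-- A good coloring of the rim. -/
def Good {n : ℕ} (g : Fin n → ℕ) : Prop :=
  (∀ i, g i ≠ g (sc i)) ∧
    ∀ i, ¬ (g i = g (sc (sc i)) ∧ g (sc (sc i)) = g (sc (sc (sc (sc i)))))

lemma lower {n : ℕ} (hn : 4 ≤ n) {c : Sym2 (Fin n ⊕ Fin 2) → ℕ} {k : ℕ}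
    (hc : IsPColoring (joinCI n) IsSemistrongMatching c k) :
    ∃ g : Fin n → ℕ, Good g ∧ 2 * n + (Finset.univ.image g).card ≤ k := by
  obtain ⟨hk, hM⟩ := hc
  refine ⟨fun i => c (rimE i), ⟨fun i h => ?_, fun i h => ?_⟩, ?_⟩
  · exact rim_two hn (hM (c (rimE i))) ⟨rimE_mem hn _, rfl⟩ ⟨rimE_mem hn _, h.symm⟩
  · exact rim_three hn (hM (c (rimE i))) ⟨rimE_mem hn _, rfl⟩ ⟨rimE_mem hn _, h.1.symm⟩
      ⟨rimE_mem hn _, (h.1.trans h.2).symm⟩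
  · have hinj : Function.Injective (fun p : Fin n × Fin 2 => c (spoke p)) := by
      intro p q h
      exact (spoke_inj (spoke_single hn (hM (c (spoke p))) ⟨spoke_mem _, rfl⟩
        ⟨spoke_mem q, h.symm⟩)).symm
    have h2 : (Finset.univ.image (fun p : Fin n × Fin 2 => c (spoke p))).card = 2 * n := by
      rw [Finset.card_image_of_injective _ hinj]
      simp [mul_comm]
    rw [← h2, ← Finset.card_union_of_disjoint]
    · refine le_trans (Finset.card_le_card (t := Finset.range k) ?_) (by simp)
      intro x hx
      simp only [Finset.mem_union, Finset.mem_image, Finset.mem_univ, true_and] at hx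
      rw [Finset.mem_range]
      rcases hx with ⟨p, rfl⟩ | ⟨i, rfl⟩
      · exact hk _ (spoke_mem _)
      · exact hk _ (rimE_mem hn _)
    · rw [Finset.disjoint_left]
      intro x hx hy
      simp only [Finset.mem_image, Finset.mem_univ, true_and] at hx hy
      obtain ⟨p, rfl⟩ := hx
      obtain ⟨i, hi⟩ := hy
      exact rimE_ne_spoke (spoke_single hn (hM (c (spoke p))) ⟨spoke_mem _, rfl⟩
        ⟨rimE_mem hn i, hi⟩)

lemma upper {n : ℕ} (hn : 4 ≤ n) {g : Fin n → ℕ} (hg : Good g) {m : ℕ} (hm : ∀ i, g i < m) :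
    ∃ c, IsPColoring (joinCI n) IsSemistrongMatching c (2 * n + m) := by
  classical
  obtain ⟨c, hcr, hcs⟩ : ∃ c : Sym2 (Fin n ⊕ Fin 2) → ℕ, (∀ i, c (rimE i) = g i) ∧
      ∀ p, c (spoke p) = m + 2 * p.1.val + p.2.val := by
    refine ⟨fun e => if h : ∃ i, e = rimE i then g h.choose else
      if h : ∃ p, e = spoke p then m + 2 * h.choose.1.val + h.choose.2.val else 0, ?_, ?_⟩
    · intro i
      have h : ∃ j, rimE i = rimE j := ⟨i, rfl⟩
      dsimp only
      rw [dif_pos h, ← rimE_inj hn h.choose_spec]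
    · intro p
      have h : ∃ q, spoke p = spoke q := ⟨p, rfl⟩
      have h' : ¬ ∃ i, spoke p = rimE i := fun ⟨i, hi⟩ => rimE_ne_spoke hi.symm
      dsimp only
      rw [dif_neg h', dif_pos h, ← spoke_inj h.choose_spec]
  refine ⟨c, fun e he => ?_, fun col => ?_⟩
  · rcases edge_cases hn he with ⟨i, rfl⟩ | ⟨p, rfl⟩
    · rw [hcr]
      have := hm i
      omega
    · rw [hcs]
      have := p.1.isLt
      have := p.2.isLt
      omega
  · by_cases hcol : col < m
    · -- rim class
      set M : Set (Sym2 (Fin n ⊕ Fin 2)) := {e | e ∈ (joinCI n).edgeSet ∧ c e = col} with hMdef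
      have hmem : ∀ e ∈ M, ∃ i, e = rimE i ∧ g i = col := by
        rintro e ⟨he, hce⟩
        rcases edge_cases hn he with ⟨i, rfl⟩ | ⟨p, rfl⟩
        · exact ⟨i, rfl, by rw [← hcr, hce]⟩
        · rw [hcs] at hce
          omega
      have hmem' : ∀ i, g i = col → rimE i ∈ M := fun i hi => ⟨rimE_mem hn i, by rw [hcr, hi]⟩
      have hcovr : ∀ k, Sum.inr k ∉ cov M := by
        rintro k ⟨e, he, hk⟩
        obtain ⟨i, rfl, -⟩ := hmem e he
        simp [rimE] at hk
      have hcovl : ∀ j, Sum.inl j ∈ cov M → g j = col ∨ ∃ p, sc p = j ∧ g p = col := by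
        rintro k ⟨e, he, hk⟩
        obtain ⟨i, rfl, hi⟩ := hmem e he
        simp only [rimE, Sym2.mem_iff, Sum.inl.injEq] at hk
        rcases hk with rfl | rfl
        · exact Or.inl hi
        · exact Or.inr ⟨i, rfl, hi⟩
      refine ⟨⟨fun e he => he.1, ?_⟩, ?_⟩
      · intro e he f hf hef v hve hvf
        obtain ⟨i, rfl, hi⟩ := hmem e he
        obtain ⟨j, rfl, hj⟩ := hmem f hf
        simp only [rimE, Sym2.mem_iff] at hve hvf
        have hij : i ≠ j := fun h => hef (by rw [h])
        rcases hve with rfl | rfl <;> simp only [Sum.inl.injEq] at hvf <;> rcases hvf with h | h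
        · exact hij h
        · subst h
          exact hg.1 j (by rw [hi, hj])
        · subst h
          exact hg.1 i (by rw [hi, hj])
        · exact hij (sc_inj h)
      · intro e he
        obtain ⟨i, rfl, hi⟩ := hmem e he
        have ci : Sum.inl i ∈ cov M := ⟨_, he, by simp [rimE]⟩
        have csi : Sum.inl (sc i) ∈ cov M := ⟨_, he, by simp [rimE]⟩
        by_cases h2 : g (sc (sc i)) = col
        · -- the tail is pendant
          refine ⟨Sum.inl i, by simp [rimE], ci, Sum.inl (sc i),
            ⟨csi, (adj_ll hn _ _).2 (Or.inl rfl)⟩, ?_⟩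
          rintro (u | u) ⟨hu, hadj⟩
          · rw [adj_ll hn] at hadj
            rcases hadj with rfl | rfl
            · rfl
            · exfalso
              rcases hcovl u hu with h | ⟨p, rfl, hp⟩
              · exact hg.1 u (by rw [h, hi])
              · exact hg.2 p ⟨by rw [hp, hi], by rw [hi, h2]⟩
          · exact absurd hu (hcovr u)
        · refine ⟨Sum.inl (sc i), by simp [rimE], csi, Sum.inl i,
            ⟨ci, (adj_ll hn _ _).2 (Or.inr rfl)⟩, ?_⟩
          rintro (u | u) ⟨hu, hadj⟩
          · rw [adj_ll hn] at hadj
            rcases hadj with rfl | h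
            · exfalso
              rcases hcovl _ hu with h | ⟨p, hp', hp⟩
              · exact h2 h
              · have := sc_inj hp'
                subst this
                exact hg.1 i (by rw [hp, hi])
            · rw [sc_inj h]
          · exact absurd hu (hcovr u)
    · -- spoke class
      have huniq : ∀ e ∈ (joinCI n).edgeSet, c e = col → ∀ f ∈ (joinCI n).edgeSet, c f = col →
          e = f := by
        intro e he hce f hf hcf
        rcases edge_cases hn he with ⟨i, rfl⟩ | ⟨p, rfl⟩
        · have := hm i
          rw [hcr] at hce
          omega
        · rcases edge_cases hn hf with ⟨i, rfl⟩ | ⟨q, rfl⟩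
          · have := hm i
            rw [hcr] at hcf
            omega
          · rw [hcs] at hce hcf
            have := p.2.isLt
            have := q.2.isLt
            rw [show p = q from Prod.ext (Fin.ext (by omega)) (Fin.ext (by omega))]
      refine ⟨⟨fun e he => he.1, ?_⟩, ?_⟩
      · rintro e ⟨he, hce⟩ f ⟨hf, hcf⟩ hef
        exact absurd (huniq e he hce f hf hcf) hef
      · rintro e ⟨he, hce⟩
        have hcov : ∀ v ∈ cov {e | e ∈ (joinCI n).edgeSet ∧ c e = col}, v ∈ e := by
          rintro v ⟨f, ⟨hf, hcf⟩, hv⟩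
          rwa [huniq e he hce f hf hcf]
        have hmem : ∀ v ∈ e, v ∈ cov {e | e ∈ (joinCI n).edgeSet ∧ c e = col} :=
          fun v hv => ⟨e, ⟨he, hce⟩, hv⟩
        clear hce huniq
        induction e using Sym2.ind with
        | _ x y =>
          refine ⟨x, by simp, hmem x (by simp), y, ⟨hmem y (by simp), he⟩, ?_⟩
          rintro u ⟨hu, hadj⟩
          have := hcov u hu
          rw [Sym2.mem_iff] at this
          rcases this with rfl | rfl
          · exact absurd hadj (SimpleGraph.irrefl _)
          · rfl

lemma good3 {n : ℕ} (hn : 4 ≤ n) (h4 : n ≠ 4) (h7 : n ≠ 7) :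
    ∃ g : Fin n → ℕ, Good g ∧ ∀ i, g i < 3 := by
  by_cases h0 : n % 3 = 0
  · refine ⟨fun i => i.val % 3, ⟨fun i => ?_, fun i => ?_⟩, fun i => by dsimp only; omega⟩
    · have := i.isLt
      simp only [sc_val]
      split_ifs <;> omega
    · have := i.isLt
      simp only [sc_val]
      split_ifs <;> omega
  by_cases h2 : n % 3 = 2
  · refine ⟨fun i => if i.val + 2 < n then i.val % 3 else (i.val + 1) % 3,
      ⟨fun i => ?_, fun i => ?_⟩, fun i => by dsimp only; split_ifs <;> omega⟩
    · have := i.isLt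
      simp only [sc_val]
      split_ifs <;> omega
    · have := i.isLt
      simp only [sc_val]
      split_ifs <;> omega
  · refine ⟨fun i => if i.val + 7 < n then i.val % 3 else if i.val + 2 < n then (i.val + 1) % 3
      else (i.val + 2) % 3,
      ⟨fun i => ?_, fun i => ?_⟩, fun i => by dsimp only; split_ifs <;> omega⟩
    · have := i.isLt
      simp only [sc_val]
      split_ifs <;> omega
    · have := i.isLt
      simp only [sc_val]
      split_ifs <;> omega

lemma good4 {n : ℕ} (hn : n = 4 ∨ n = 7) : ∃ g : Fin n → ℕ, Good g ∧ ∀ i, g i < 4 := by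
  rcases hn with rfl | rfl
  · exact ⟨fun i => i.val, by unfold Good; decide, fun i => i.isLt⟩
  · exact ⟨fun i => if i.val = 6 then 3 else i.val % 3, by unfold Good; decide, by decide⟩

lemma card3 {n : ℕ} (hn : 4 ≤ n) {g : Fin n → ℕ} (hg : Good g) :
    3 ≤ (Finset.univ.image g).card := by
  set z : Fin n := ⟨0, by omega⟩
  have hm : ∀ i, g i ∈ Finset.univ.image g := fun i => Finset.mem_image_of_mem _ (Finset.mem_univ _)
  by_contra hlt
  have h3 : ∀ i, g (sc (sc i)) = g i := by
    intro i
    by_contra hne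
    refine hlt (Finset.two_lt_card.2 ⟨g i, hm _, g (sc i), hm _, g (sc (sc i)), hm _, hg.1 _,
      Ne.symm hne, hg.1 _⟩)
  exact hg.2 z ⟨(h3 _).symm, (h3 _).symm⟩

set_option synthInstance.maxSize 2000 in
set_option synthInstance.maxHeartbeats 400000 in
set_option maxRecDepth 10000 in
lemma seq7 : ∀ a b : Fin 3, a ≠ b → ∀ c : Fin 3, b ≠ c → ∀ d : Fin 3, c ≠ d → ∀ e : Fin 3, d ≠ e →
    ¬ (a = c ∧ c = e) → ∀ f : Fin 3, e ≠ f → ¬ (b = d ∧ d = f) → ∀ h : Fin 3, f ≠ h → h ≠ a →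
    ¬ (c = e ∧ e = h) → ¬ (d = f ∧ f = a) → ¬ (e = h ∧ h = b) → ¬ (f = a ∧ a = c) →
    ¬ (h = b ∧ b = d) → False := by decide

lemma card4 {n : ℕ} (hn : n = 4 ∨ n = 7) {g : Fin n → ℕ} (hg : Good g) :
    4 ≤ (Finset.univ.image g).card := by
  rcases hn with rfl | rfl
  · rw [Finset.card_image_of_injective]
    · simp
    · obtain ⟨h1, h2⟩ := hg
      have a0 := h1 0
      have a1 := h1 1
      have a2 := h1 2
      have a3 := h1 3
      have b0 := h2 0
      have b1 := h2 1
      simp only [show sc (0 : Fin 4) = 1 from rfl, show sc (1 : Fin 4) = 2 from rfl,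
        show sc (2 : Fin 4) = 3 from rfl, show sc (3 : Fin 4) = 0 from rfl] at *
      intro i j hij
      fin_cases i <;> fin_cases j <;> simp_all
  · by_contra hlt
    have h3 : (Finset.univ.image g).card = 3 := le_antisymm (by omega) (card3 (by norm_num) hg)
    let e := Finset.equivFinOfCardEq h3
    let G : Fin 7 → Fin 3 := fun i => e ⟨g i, Finset.mem_image_of_mem _ (Finset.mem_univ _)⟩
    have hG : ∀ i j, G i = G j ↔ g i = g j := by
      intro i j
      simp [G]
    obtain ⟨h1, h2⟩ := hg
    simp only [← hG, ne_eq] at h1 h2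
    exact seq7 (G 0) (G 1) (h1 0) (G 2) (h1 1) (G 3) (h1 2) (G 4) (h1 3) (h2 0) (G 5) (h1 4)
      (h2 1) (G 6) (h1 5) (h1 6) (h2 2) (h2 3) (h2 4) (h2 5) (h2 6)

/-- For `Δ ≥ 4`, the graph `C_Δ ∨ I_2` is planar, has maximum degree `Δ`, and its
semistrong chromatic index equals `2Δ+4` if `Δ ∈ {4,7}` and `2Δ+3` otherwise. -/
theorem joinCI_planar_maxDegree_ssIndex (Δ : ℕ) (hΔ : 4 ≤ Δ) :
    IsPlanar (joinCI Δ) ∧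
    (∀ v, natDeg (joinCI Δ) v ≤ Δ) ∧ (∃ v, natDeg (joinCI Δ) v = Δ) ∧
    ssIndex (joinCI Δ) = (if Δ = 4 ∨ Δ = 7 then 2 * Δ + 4 else 2 * Δ + 3) := by
  refine ⟨⟨no_K5 hΔ, no_K33 hΔ⟩, ?_, ⟨Sum.inr 0, natDeg_r 0⟩, ?_⟩
  · rintro (i | k)
    · exact natDeg_l hΔ i
    · exact (natDeg_r k).le
  · have key : ∀ m, (∃ g : Fin Δ → ℕ, Good g ∧ ∀ i, g i < m) →
        (∀ g : Fin Δ → ℕ, Good g → m ≤ (Finset.univ.image g).card) →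
        ssIndex (joinCI Δ) = 2 * Δ + m := by
      rintro m ⟨g, hg, hm⟩ hl
      have hu := upper hΔ hg hm
      apply le_antisymm
      · exact Nat.sInf_le hu
      · refine le_csInf ⟨_, hu⟩ ?_
        rintro k ⟨c, hc⟩
        obtain ⟨g', hg', hk⟩ := lower hΔ hc
        have := hl g' hg'
        omega
    split_ifs with h
    · exact key 4 (good4 h) (fun g hg => card4 h hg)
    · push Not at h
      exact key 3 (good3 hΔ h.1 h.2) (fun g hg => card3 hΔ hg)

end SSE
end

section
/- Let G be a graph with maximum degree Δ ≥ 2 and maximum average degree less than 8/3. Then G has a semistrong edge coloring with at most 2Δ + 2 colors, i.e., χ'_ss(G) ≤ 2Δ + 2. -/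
namespace SSE

open SimpleGraph

variable {V : Type*} {W : Type*}

/-! ### Auxiliary development: semistrong colourings with a chosen pendant end (tail) per edge -/

section Aux

open Finset Classical

/-- Neighbours of `v` as a finset. -/
noncomputable def nb {V : Type*} [Fintype V] (F : V → V → Prop) (v : V) : Finset V :=
  Finset.univ.filter (fun w => F v w)

theorem mem_nb {V : Type*} [Fintype V] {F : V → V → Prop} {v w : V} : w ∈ nb F v ↔ F v w := by
  simp [nb]

/-- A partial colouring `c` of the edges `F` of `G`; `O x` is the set of the `y` such that
`x` is the chosen pendant end of `xy`. -/
structure PC {V : Type*} (G : SimpleGraph V) (F : V → V → Prop) (c : V → V → ℕ)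
    (O : V → Finset V) (K : ℕ) : Prop where
  symF : ∀ a b, F a b → F b a
  sub : ∀ a b, F a b → G.Adj a b
  csym : ∀ a b, c a b = c b a
  lt : ∀ a b, F a b → c a b < K
  osub : ∀ a b, b ∈ O a → F a b
  cover : ∀ a b, F a b → b ∈ O a ∨ a ∈ O b
  valid : ∀ x y z w, y ∈ O x → G.Adj x z → F z w → ¬ (z = y ∧ w = x) → c z w ≠ c x y

/-- The bounds on the tails. -/
structure TB {V : Type*} (O : V → Finset V) : Prop where
  two : ∀ u, (O u).card ≤ 2
  inv : ∀ w p q, p ∈ O w → q ∈ O w → p ≠ q → (O p).card ≤ 1 ∨ (O q).card ≤ 1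

/-- Colour `α` may be used on the new edge `xy` with tail `x`. -/
def OKc {V : Type*} (G : SimpleGraph V) (F : V → V → Prop) (c : V → V → ℕ)
    (O : V → Finset V) (x y : V) (α : ℕ) : Prop :=
  (∀ z w, G.Adj x z → F z w → c z w ≠ α) ∧ (∀ z w, G.Adj y z → w ∈ O z → c z w ≠ α)

/-- Add an edge. -/
def addF {V : Type*} (F : V → V → Prop) (x y : V) : V → V → Prop :=
  fun p q => F p q ∨ (p = x ∧ q = y) ∨ (p = y ∧ q = x)

/-- Colour an edge. -/
noncomputable def addC {V : Type*} (c : V → V → ℕ) (x y : V) (α : ℕ) : V → V → ℕ :=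
  fun p q => if (p = x ∧ q = y) ∨ (p = y ∧ q = x) then α else c p q

/-- Add a tail. -/
noncomputable def addO {V : Type*} (O : V → Finset V) (x y : V) : V → Finset V :=
  fun p => if p = x then insert y (O p) else O p

theorem mem_addO {V : Type*} {O : V → Finset V} {x y p q : V} :
    q ∈ addO O x y p ↔ q ∈ O p ∨ (p = x ∧ q = y) := by
  unfold addO
  split_ifs with h <;> simp [h]
  tauto

theorem addC_old {V : Type*} {F : V → V → Prop} (hs : ∀ a b, F a b → F b a)
    {c : V → V → ℕ} {x y p q : V} {α : ℕ}
    (hn : ¬ F x y) (h : F p q) : addC c x y α p q = c p q := by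
  unfold addC
  rw [if_neg]
  rintro (⟨rfl, rfl⟩ | ⟨rfl, rfl⟩)
  · exact hn h
  · exact hn (hs _ _ h)

theorem PC.add {V : Type*} {G : SimpleGraph V} {F : V → V → Prop} {c : V → V → ℕ}
    {O : V → Finset V} {K : ℕ} (h : PC G F c O K) {x y : V} {α : ℕ} (hxy : G.Adj x y)
    (hn : ¬ F x y) (hα : α < K) (hok : OKc G F c O x y α) :
    PC G (addF F x y) (addC c x y α) (addO O x y) K := by
  have hne := hxy.ne
  have hold : ∀ p q, F p q → addC c x y α p q = c p q := fun p q hpq =>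
    addC_old h.symF hn hpq
  have hxy1 : addC c x y α x y = α := by simp [addC]
  have hxy2 : addC c x y α y x = α := by simp [addC]
  constructor
  · rintro a b (h1 | h1 | h1)
    · exact Or.inl (h.symF _ _ h1)
    · exact Or.inr (Or.inr ⟨h1.2, h1.1⟩)
    · exact Or.inr (Or.inl ⟨h1.2, h1.1⟩)
  · rintro a b (h1 | ⟨rfl, rfl⟩ | ⟨rfl, rfl⟩)
    · exact h.sub _ _ h1
    · exact hxy
    · exact hxy.symm
  · intro a b
    unfold addC
    rw [h.csym a b]
    have : ((a = x ∧ b = y) ∨ (a = y ∧ b = x)) ↔ ((b = x ∧ a = y) ∨ (b = y ∧ a = x)) := by tauto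
    simp only [this]
  · rintro a b (h1 | ⟨rfl, rfl⟩ | ⟨rfl, rfl⟩)
    · rw [hold _ _ h1]; exact h.lt _ _ h1
    · rw [hxy1]; exact hα
    · rw [hxy2]; exact hα
  · intro a b hb
    rcases mem_addO.1 hb with h1 | ⟨rfl, rfl⟩
    · exact Or.inl (h.osub _ _ h1)
    · exact Or.inr (Or.inl ⟨rfl, rfl⟩)
  · rintro a b (h1 | ⟨rfl, rfl⟩ | ⟨rfl, rfl⟩)
    · rcases h.cover _ _ h1 with h2 | h2
      · exact Or.inl (mem_addO.2 (Or.inl h2))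
      · exact Or.inr (mem_addO.2 (Or.inl h2))
    · exact Or.inl (mem_addO.2 (Or.inr ⟨rfl, rfl⟩))
    · exact Or.inr (mem_addO.2 (Or.inr ⟨rfl, rfl⟩))
  · intro p q z w hq hpz hzw hnn
    rcases mem_addO.1 hq with h1 | ⟨rfl, rfl⟩
    · rw [hold p q (h.osub _ _ h1)]
      rcases hzw with h2 | ⟨rfl, rfl⟩ | ⟨rfl, rfl⟩
      · rw [hold z w h2]; exact h.valid p q z w h1 hpz h2 hnn
      · rw [hxy1]; exact (hok.1 p q hpz.symm (h.osub _ _ h1)).symm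
      · rw [hxy2]; exact (hok.2 p q hpz.symm h1).symm
    · rw [hxy1]
      rcases hzw with h2 | ⟨rfl, rfl⟩ | ⟨rfl, rfl⟩
      · rw [hold z w h2]; exact hok.1 z w hpz h2
      · exact absurd hpz (G.loopless.irrefl _)
      · exact absurd ⟨rfl, rfl⟩ hnn

theorem OKc.update {V : Type*} {G : SimpleGraph V} {F : V → V → Prop} {c : V → V → ℕ}
    {O : V → Finset V} {K : ℕ} (h : PC G F c O K) {x y x' y' : V} {α β : ℕ}
    (hn : ¬ F x y) (hok : OKc G F c O x' y' β)
    (hc : α ≠ β ∨ (¬ G.Adj x' x ∧ ¬ G.Adj x' y ∧ ¬ G.Adj y' x)) :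
    OKc G (addF F x y) (addC c x y α) (addO O x y) x' y' β := by
  have hold : ∀ p q, F p q → addC c x y α p q = c p q := fun p q hpq =>
    addC_old h.symF hn hpq
  have hxy1 : addC c x y α x y = α := by simp [addC]
  have hxy2 : addC c x y α y x = α := by simp [addC]
  constructor
  · rintro z w h1 (h2 | ⟨rfl, rfl⟩ | ⟨rfl, rfl⟩)
    · rw [hold _ _ h2]; exact hok.1 _ _ h1 h2
    · rw [hxy1]; tauto
    · rw [hxy2]; tauto
  · intro z w h1 h2
    rcases mem_addO.1 h2 with h3 | ⟨rfl, rfl⟩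
    · rw [hold _ _ (h.osub _ _ h3)]; exact hok.2 _ _ h1 h3
    · rw [hxy1]; tauto

theorem PC.congr {V : Type*} {G : SimpleGraph V} {F F' : V → V → Prop} {c : V → V → ℕ}
    {O : V → Finset V} {K : ℕ} (h : PC G F c O K) (hF : ∀ a b, F a b ↔ F' a b) :
    PC G F' c O K := by
  have : F = F' := by
    funext a b
    exact propext (hF a b)
  exact this ▸ h

/-- Delete all the edges at the vertices of `D`. -/
def del {V : Type*} (G : SimpleGraph V) (D : Set V) : SimpleGraph V where
  Adj a b := G.Adj a b ∧ a ∉ D ∧ b ∉ D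
  symm := ⟨fun _ _ h => ⟨h.1.symm, h.2.2, h.2.1⟩⟩
  loopless := ⟨fun _ h => G.loopless.irrefl _ h.1⟩

theorem PC.ofDel {V : Type*} {G : SimpleGraph V} {D : Set V} {c : V → V → ℕ}
    {O : V → Finset V} {K : ℕ} (h : PC (del G D) (del G D).Adj c O K) :
    PC G (del G D).Adj c O K where
  symF := h.symF
  sub := fun _ _ h => h.1
  csym := h.csym
  lt := h.lt
  osub := h.osub
  cover := h.cover
  valid := fun x y z w h1 h2 h3 h4 =>
    h.valid x y z w h1 ⟨h2, (h.osub _ _ h1).2.1, h3.2.1⟩ h3 h4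

/-- The total size of the tails around `y`. -/
theorem sum_tails {V : Type*} [Fintype V] {G : SimpleGraph V} {F : V → V → Prop} {c : V → V → ℕ}
    {O : V → Finset V} {K : ℕ} (h : PC G F c O K) (ht : TB O) (y : V) :
    ∑ z ∈ nb F y, ((O z).erase y).card ≤ (nb F y).card + 1 := by
  have hb : ((nb F y).filter (fun z => 1 < ((O z).erase y).card)).card ≤ 1 := by
    rw [Finset.card_le_one]
    intro p hp q hq
    by_contra hpq
    have key : ∀ p ∈ (nb F y).filter (fun z => 1 < ((O z).erase y).card),
        p ∈ O y ∧ ¬ (O p).card ≤ 1 := by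
      intro p hp
      rw [Finset.mem_filter, mem_nb] at hp
      have h2 := ht.two p
      have h3 : ((O p).erase y).card ≤ (O p).card := Finset.card_erase_le
      refine ⟨?_, by omega⟩
      rcases h.cover _ _ hp.1 with h4 | h4
      · exact h4
      · have := Finset.card_erase_of_mem h4
        omega
    have h1 := key p hp
    have h2 := key q hq
    rcases ht.inv y p q h1.1 h2.1 hpq with h3 | h3
    · exact h1.2 h3
    · exact h2.2 h3
  calc ∑ z ∈ nb F y, ((O z).erase y).card
      ≤ ∑ z ∈ nb F y, (1 + if 1 < ((O z).erase y).card then 1 else 0) := by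
        apply Finset.sum_le_sum
        intro z _
        have h2 := ht.two z
        have h3 : ((O z).erase y).card ≤ (O z).card := Finset.card_erase_le
        split_ifs <;> omega
    _ = (nb F y).card + ((nb F y).filter (fun z => 1 < ((O z).erase y).card)).card := by
        rw [Finset.sum_add_distrib, Finset.card_filter]
        simp
    _ ≤ _ := by omega

/-- Available colours. -/
noncomputable def av {V : Type*} (G : SimpleGraph V) (F : V → V → Prop) (c : V → V → ℕ)
    (O : V → Finset V) (K : ℕ) (x y : V) : Finset ℕ :=
  (Finset.range K).filter (fun α => OKc G F c O x y α)

theorem card_av {V : Type*} [Fintype V] {G : SimpleGraph V} {F : V → V → Prop} {c : V → V → ℕ}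
    {O : V → Finset V} {K : ℕ} (h : PC G F c O K) (ht : TB O) {x y : V} (hxy : G.Adj x y)
    (hF : ∀ z w, G.Adj y z → w ∈ O z → F y z) :
    K ≤ (av G F c O K x y).card + ((∑ z ∈ nb G.Adj x, (nb F z).card) + (nb F y).card + 1) := by
  set A := (nb G.Adj x).biUnion (fun z => (nb F z).image (c z)) with hA
  set B := (nb F y).biUnion (fun z => ((O z).erase y).image (c z)) with hB
  have hsub : Finset.range K ⊆ av G F c O K x y ∪ (A ∪ B) := by
    intro α hα
    by_contra hcon
    simp only [Finset.mem_union, not_or] at hcon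
    obtain ⟨h1, h2, h3⟩ := hcon
    apply h1
    refine Finset.mem_filter.2 ⟨hα, ?_, ?_⟩
    · intro z w hz hw he
      apply h2
      rw [hA, Finset.mem_biUnion]
      exact ⟨z, mem_nb.2 hz, Finset.mem_image.2 ⟨w, mem_nb.2 hw, he⟩⟩
    · intro z w hz hw he
      by_cases hwy : w = y
      · subst hwy
        apply h2
        rw [hA, Finset.mem_biUnion]
        refine ⟨w, mem_nb.2 hxy, Finset.mem_image.2 ⟨z, mem_nb.2 (hF _ _ hz hw), ?_⟩⟩
        rw [h.csym]; exact he
      · apply h3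
        rw [hB, Finset.mem_biUnion]
        exact ⟨z, mem_nb.2 (hF _ _ hz hw), Finset.mem_image.2
          ⟨w, Finset.mem_erase.2 ⟨hwy, hw⟩, he⟩⟩
  have h1 := Finset.card_le_card hsub
  have h2 := Finset.card_union_le (av G F c O K x y) (A ∪ B)
  have h3 := Finset.card_union_le A B
  have h4 : A.card ≤ ∑ z ∈ nb G.Adj x, (nb F z).card :=
    Finset.card_biUnion_le.trans (Finset.sum_le_sum fun z _ => Finset.card_image_le)
  have h5 : B.card ≤ ∑ z ∈ nb F y, ((O z).erase y).card :=
    Finset.card_biUnion_le.trans (Finset.sum_le_sum fun z _ => Finset.card_image_le)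
  have h6 := sum_tails h ht y
  rw [Finset.card_range] at h1
  omega

/-- Choosing distinct colours from four lists, the first two of which may share a colour. -/
theorem pick_four (L1 L2 L3 L4 : Finset ℕ) (h1 : 2 ≤ L1.card) (h2 : 2 ≤ L2.card)
    (h3 : 3 ≤ L3.card) (h4 : 3 ≤ L4.card) :
    ∃ a ∈ L1, ∃ b ∈ L2, ∃ c ∈ L3, ∃ d ∈ L4, a ≠ c ∧ a ≠ d ∧ b ≠ c ∧ b ≠ d ∧ c ≠ d := by
  have ex : ∀ (L : Finset ℕ) (s : Finset ℕ), s.card < L.card → ∃ a ∈ L, a ∉ s := by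
    intro L s h
    exact Finset.exists_mem_notMem_of_card_lt_card h
  by_cases hd : Disjoint L1 L2
  · obtain ⟨L3', hL3, hc3⟩ := Finset.exists_subset_card_eq h3
    have hu : L3'.card < (L1 ∪ L2).card := by
      rw [Finset.card_union_of_disjoint hd]; omega
    obtain ⟨a, ha, ha3⟩ := ex _ _ hu
    rcases Finset.mem_union.1 ha with ha | ha
    · obtain ⟨b, hb⟩ : L2.Nonempty := Finset.card_pos.1 (by omega)
      obtain ⟨d, hd, hd'⟩ := ex L4 {a, b} (lt_of_le_of_lt Finset.card_le_two (by omega))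
      obtain ⟨c, hc, hc'⟩ := ex L3' {b, d} (lt_of_le_of_lt Finset.card_le_two (by omega))
      refine ⟨a, ha, b, hb, c, hL3 hc, d, hd, ?_⟩
      simp only [Finset.mem_insert, Finset.mem_singleton, not_or] at hd' hc'
      refine ⟨?_, Ne.symm hd'.1, Ne.symm hc'.1, Ne.symm hd'.2, hc'.2⟩
      rintro rfl; exact ha3 hc
    · obtain ⟨b, hb⟩ : L1.Nonempty := Finset.card_pos.1 (by omega)
      obtain ⟨d, hd, hd'⟩ := ex L4 {a, b} (lt_of_le_of_lt Finset.card_le_two (by omega))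
      obtain ⟨c, hc, hc'⟩ := ex L3' {b, d} (lt_of_le_of_lt Finset.card_le_two (by omega))
      refine ⟨b, hb, a, ha, c, hL3 hc, d, hd, ?_⟩
      simp only [Finset.mem_insert, Finset.mem_singleton, not_or] at hd' hc'
      refine ⟨Ne.symm hc'.1, Ne.symm hd'.2, ?_, Ne.symm hd'.1, hc'.2⟩
      rintro rfl; exact ha3 hc
  · rw [Finset.not_disjoint_iff] at hd
    obtain ⟨a, ha1, ha2⟩ := hd
    obtain ⟨c, hc, hc'⟩ := ex L3 {a} (by rw [Finset.card_singleton]; omega)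
    obtain ⟨d, hd, hd'⟩ := ex L4 {a, c} (lt_of_le_of_lt Finset.card_le_two (by omega))
    refine ⟨a, ha1, a, ha2, c, hc, d, hd, ?_⟩
    simp only [Finset.mem_insert, Finset.mem_singleton, not_or] at hd' hc'
    exact ⟨Ne.symm hc', Ne.symm hd'.1, Ne.symm hc', Ne.symm hd'.1, Ne.symm hd'.2⟩

theorem pick_four' (L1 L2 L3 L4 : Finset ℕ) (h1 : 4 ≤ L1.card) (h2 : 4 ≤ L2.card)
    (h3 : 4 ≤ L3.card) (h4 : 4 ≤ L4.card) :
    ∃ a ∈ L1, ∃ b ∈ L2, ∃ c ∈ L3, ∃ d ∈ L4,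
      a ≠ c ∧ a ≠ d ∧ b ≠ c ∧ b ≠ d ∧ c ≠ d ∧ a ≠ b := by
  have ex : ∀ (L : Finset ℕ) (s : Finset ℕ), s.card < L.card → ∃ a ∈ L, a ∉ s := by
    intro L s h
    exact Finset.exists_mem_notMem_of_card_lt_card h
  obtain ⟨a, ha⟩ : L1.Nonempty := Finset.card_pos.1 (by omega)
  obtain ⟨b, hb, hbb⟩ := ex L2 {a} (by rw [Finset.card_singleton]; omega)
  obtain ⟨c, hc, hc'⟩ := ex L3 {a, b} (lt_of_le_of_lt Finset.card_le_two (by omega))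
  obtain ⟨d, hd, hd'⟩ := ex L4 {a, b, c} (lt_of_le_of_lt Finset.card_le_three (by omega))
  refine ⟨a, ha, b, hb, c, hc, d, hd, ?_⟩
  simp only [Finset.mem_insert, Finset.mem_singleton, not_or] at hbb hc' hd'
  exact ⟨Ne.symm hc'.1, Ne.symm hd'.1, Ne.symm hc'.2, Ne.symm hd'.2.1, Ne.symm hd'.2.2, Ne.symm hbb⟩

/-- A good colouring exists. -/
def HasGood {V : Type*} (G : SimpleGraph V) (K : ℕ) : Prop :=
  ∃ c O, PC G G.Adj c O K ∧ TB O

/-- Sparsity, counted by degrees. -/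
def Sparse {V : Type*} [Fintype V] (G : SimpleGraph V) : Prop :=
  ∀ S : Finset V, S.Nonempty → 3 * ∑ v ∈ S, (nb G.Adj v ∩ S).card < 8 * S.card

theorem Sparse.del {V : Type*} [Fintype V] {G : SimpleGraph V} (h : Sparse G) (D : Set V) :
    Sparse (del G D) := by
  intro S hS
  refine lt_of_le_of_lt ?_ (h S hS)
  refine Nat.mul_le_mul_left 3 (Finset.sum_le_sum fun v _ => Finset.card_le_card ?_)
  apply Finset.inter_subset_inter_right
  intro w hw
  exact mem_nb.2 (mem_nb.1 hw).1

theorem nb_del_sub {V : Type*} [Fintype V] (G : SimpleGraph V) (D : Set V) (v : V) :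
    nb (del G D).Adj v ⊆ nb G.Adj v := by
  intro w hw
  exact mem_nb.2 (mem_nb.1 hw).1

theorem card_nb_del {V : Type*} [Fintype V] (G : SimpleGraph V) (D : Set V) (v : V)
    (s : Finset V) (hs : s ⊆ nb G.Adj v) (hD : ∀ d ∈ s, d ∈ D) :
    (nb (del G D).Adj v).card + s.card ≤ (nb G.Adj v).card := by
  rw [← Finset.card_union_of_disjoint]
  · exact Finset.card_le_card (Finset.union_subset (nb_del_sub G D v) hs)
  · rw [Finset.disjoint_left]
    intro d hd hds
    exact (mem_nb.1 hd).2.2 (hD d hds)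

theorem measure_del {V : Type*} [Fintype V] (G : SimpleGraph V) (D : Set V) {v w : V}
    (hv : v ∈ D) (hw : G.Adj v w) :
    ∑ u, (nb (del G D).Adj u).card < ∑ u, (nb G.Adj u).card := by
  apply Finset.sum_lt_sum
  · intro u _
    exact Finset.card_le_card (nb_del_sub G D u)
  · refine ⟨v, Finset.mem_univ _, Finset.card_lt_card ?_⟩
    refine ⟨nb_del_sub G D v, fun h => ?_⟩
    exact (mem_nb.1 (h (mem_nb.2 hw))).2.1 hv

/-- The reducible configurations are unavoidable. -/
theorem unavoidable {V : Type*} [Fintype V] (G : SimpleGraph V) (hG : Sparse G)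
    (hne : ∃ a b, G.Adj a b) :
    (∃ x, (nb G.Adj x).card = 1) ∨
    (∃ v x, G.Adj v x ∧ (nb G.Adj v).card = 2 ∧ (nb G.Adj x).card = 2) ∨
    (∃ v x1 x2, x1 ≠ x2 ∧ G.Adj v x1 ∧ G.Adj v x2 ∧ (nb G.Adj v).card = 3 ∧
      (nb G.Adj x1).card = 2 ∧ (nb G.Adj x2).card = 2 ∧ ¬ G.Adj x1 x2) := by
  by_contra hcon
  simp only [not_or, not_exists] at hcon
  obtain ⟨h1, h2, h3⟩ := hcon
  obtain ⟨a0, b0, hab⟩ := hne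
  set S : Finset V := Finset.univ.filter (fun v => (nb G.Adj v).Nonempty) with hS
  have hmS : ∀ v, v ∈ S ↔ (nb G.Adj v).Nonempty := by intro v; simp [hS]
  have hsub : ∀ v, nb G.Adj v ⊆ S := by
    intro v w hw
    exact (hmS w).2 ⟨v, mem_nb.2 (mem_nb.1 hw).symm⟩
  have key := hG S ⟨a0, (hmS a0).2 ⟨b0, mem_nb.2 hab⟩⟩
  have e1 : ∑ v ∈ S, (nb G.Adj v ∩ S).card = ∑ v ∈ S, (nb G.Adj v).card := by
    apply Finset.sum_congr rfl
    intro v _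
    rw [Finset.inter_eq_left.2 (hsub v)]
  rw [e1] at key
  set t : V → ℕ := fun v => ((nb G.Adj v).filter (fun w => (nb G.Adj w).card = 2)).card with ht
  have hloc : ∀ v ∈ S, 8 + t v ≤ 3 * (nb G.Adj v).card +
      2 * (if (nb G.Adj v).card = 2 then 1 else 0) := by
    intro v hv
    have hpos := Finset.card_pos.2 ((hmS v).1 hv)
    have hn1 := h1 v
    have htle : t v ≤ (nb G.Adj v).card := Finset.card_filter_le _ _
    split_ifs with hd
    · have : t v = 0 := by
        rw [ht]
        simp only [Finset.card_eq_zero, Finset.filter_eq_empty_iff]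
        intro w hw hw2
        exact h2 v w ⟨mem_nb.1 hw, hd, hw2⟩
      omega
    · by_cases hd3 : (nb G.Adj v).card = 3
      · have : t v ≤ 1 := by
          rw [ht]
          simp only
          rw [Finset.card_le_one]
          intro p hp q hq
          rw [Finset.mem_filter, mem_nb] at hp hq
          by_contra hpq
          exact h3 v p q ⟨hpq, hp.1, hq.1, hd3, hp.2, hq.2,
            fun hpq' => h2 p q ⟨hpq', hp.2, hq.2⟩⟩
        omega
      · omega
  have hsum := Finset.sum_le_sum hloc
  have hcount : ∑ v ∈ S, t v = ∑ v ∈ S, 2 * (if (nb G.Adj v).card = 2 then 1 else 0) := by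
    have e2 : ∀ v ∈ S, t v = ∑ w ∈ S,
        if (G.Adj v w ∧ (nb G.Adj w).card = 2) then 1 else 0 := by
      intro v _
      rw [ht, ← Finset.card_filter]
      simp only
      congr 1
      ext w
      simp only [Finset.mem_filter, mem_nb]
      constructor
      · intro h
        exact ⟨hsub v (mem_nb.2 h.1), h⟩
      · intro h
        exact h.2
    rw [Finset.sum_congr rfl e2, Finset.sum_comm]
    apply Finset.sum_congr rfl
    intro w _
    split_ifs with hw
    · simp only [hw, and_true]
      rw [← Finset.card_filter, mul_one, ← hw]
      congr 1
      ext v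
      simp only [Finset.mem_filter, mem_nb]
      constructor
      · intro h
        exact h.2.symm
      · intro h
        exact ⟨hsub w (mem_nb.2 h), h.symm⟩
    · simp [hw]
  rw [Finset.sum_add_distrib, Finset.sum_add_distrib, ← Finset.mul_sum, hcount] at hsum
  simp only [Finset.sum_const, smul_eq_mul] at hsum
  omega

theorem TB.add_leaf {V : Type*} {O : V → Finset V} (h : TB O) {x y : V} (hx : O x = ∅)
    (hxO : ∀ u, x ∉ O u) : TB (addO O x y) := by
  have h0 : ∀ u, u ≠ x → addO O x y u = O u := fun u hu => by simp [addO, hu]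
  have h1 : addO O x y x = {y} := by simp [addO, hx]
  constructor
  · intro u
    by_cases hu : u = x
    · subst hu; simp [h1]
    · rw [h0 u hu]; exact h.two u
  · intro w p q hp hq hpq
    by_cases hw : w = x
    · subst hw
      rw [h1, Finset.mem_singleton] at hp hq
      exact absurd (hp.trans hq.symm) hpq
    · rw [h0 w hw] at hp hq
      rw [h0 p (fun e => hxO w (e ▸ hp)), h0 q (fun e => hxO w (e ▸ hq))]
      exact h.inv w p q hp hq hpq

theorem TB.add_two {V : Type*} {O : V → Finset V} (h : TB O) {x y z : V} (hx : O x = ∅)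
    (hxO : ∀ u, x ∉ O u) (hxy : x ≠ y) (hxz : x ≠ z) (hz : (O z).card ≤ 1) :
    TB (addO (addO O x y) x z) := by
  have h0 : ∀ u, u ≠ x → addO (addO O x y) x z u = O u := fun u hu => by simp [addO, hu]
  have h1 : addO (addO O x y) x z x = {z, y} := by simp [addO, hx]
  constructor
  · intro u
    by_cases hu : u = x
    · subst hu; rw [h1]; exact Finset.card_le_two
    · rw [h0 u hu]; exact h.two u
  · intro w p q hp hq hpq
    by_cases hw : w = x
    · subst hw
      rw [h1, Finset.mem_insert, Finset.mem_singleton] at hp hq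
      rcases hp with rfl | rfl
      · left; rw [h0 p hxz.symm]; exact hz
      · rcases hq with rfl | rfl
        · right; rw [h0 q hxz.symm]; exact hz
        · exact absurd rfl hpq
    · rw [h0 w hw] at hp hq
      rw [h0 p (fun e => hxO w (e ▸ hp)), h0 q (fun e => hxO w (e ▸ hq))]
      exact h.inv w p q hp hq hpq

theorem addO_comm {V : Type*} (O : V → Finset V) (x y x' y' : V) :
    addO (addO O x y) x' y' = addO (addO O x' y') x y := by
  funext p
  ext q
  simp only [mem_addO]
  tauto

theorem nb_pair {V : Type*} [Fintype V] {G : SimpleGraph V} {v x : V} (h : G.Adj v x)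
    (h2 : (nb G.Adj v).card = 2) : ∃ w, w ≠ x ∧ G.Adj v w ∧ nb G.Adj v = {x, w} := by
  obtain ⟨a, b, hab, he⟩ := Finset.card_eq_two.1 h2
  have hx : x ∈ nb G.Adj v := mem_nb.2 h
  rw [he, Finset.mem_insert, Finset.mem_singleton] at hx
  rcases hx with rfl | rfl
  · exact ⟨b, hab.symm, mem_nb.1 (by rw [he]; simp), he⟩
  · exact ⟨a, hab, mem_nb.1 (by rw [he]; simp), by rw [he, Finset.pair_comm]⟩

theorem mem_av {V : Type*} {G : SimpleGraph V} {F : V → V → Prop} {c : V → V → ℕ}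
    {O : V → Finset V} {K : ℕ} {x y : V} {α : ℕ} :
    α ∈ av G F c O K x y ↔ α < K ∧ OKc G F c O x y α := by
  simp [av]

theorem reduce_leaf {V : Type*} [Fintype V] (G : SimpleGraph V) (Δ : ℕ)
    (hub : ∀ v, (nb G.Adj v).card ≤ Δ) (x : V) (hx : (nb G.Adj x).card = 1)
    (ih : HasGood (del G {x}) (2 * Δ + 2)) : HasGood G (2 * Δ + 2) := by
  obtain ⟨c, O, hpc, ht⟩ := ih
  have h := hpc.ofDel
  have hO : O x = ∅ := by
    rw [Finset.eq_empty_iff_forall_notMem]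
    intro u hu
    exact (h.osub _ _ hu).2.1 rfl
  have hxO : ∀ u, x ∉ O u := fun u hu => (h.osub _ _ hu).2.2 rfl
  obtain ⟨y, hy⟩ := Finset.card_eq_one.1 hx
  have hxy : G.Adj x y := mem_nb.1 (by rw [hy]; simp)
  have hyx : y ≠ x := hxy.ne.symm
  have hn : ¬ (del G {x}).Adj x y := fun h => h.2.1 rfl
  have hdy := card_nb_del G {x} y {x} (by
    intro d hd
    rw [Finset.mem_singleton] at hd
    subst hd
    exact mem_nb.2 hxy.symm) (by simp)
  rw [Finset.card_singleton] at hdy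
  have hb := hub y
  have hav := card_av h ht hxy (fun z w hz hw => ⟨hz, hyx, (h.osub _ _ hw).2.1⟩)
  rw [hy, Finset.sum_singleton] at hav
  obtain ⟨α, hα⟩ : (av G (del G {x}).Adj c O (2 * Δ + 2) x y).Nonempty :=
    Finset.card_pos.1 (by omega)
  rw [mem_av] at hα
  refine ⟨_, _, (h.add hxy hn hα.1 hα.2).congr ?_, ht.add_leaf hO hxO⟩
  intro a b
  constructor
  · rintro (h1 | ⟨rfl, rfl⟩ | ⟨rfl, rfl⟩)
    · exact h1.1
    · exact hxy
    · exact hxy.symm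
  · intro hab
    have hnx : ∀ u, G.Adj x u → u = y := by
      intro u hu
      have : u ∈ nb G.Adj x := mem_nb.2 hu
      rwa [hy, Finset.mem_singleton] at this
    by_cases ha : a = x
    · subst ha
      exact Or.inr (Or.inl ⟨rfl, hnx _ hab⟩)
    · by_cases hb : b = x
      · subst hb
        exact Or.inr (Or.inr ⟨hnx _ hab.symm, rfl⟩)
      · exact Or.inl ⟨hab, ha, hb⟩

theorem reduce_two {V : Type*} [Fintype V] (G : SimpleGraph V) (Δ : ℕ) (hΔ : 2 ≤ Δ)
    (hub : ∀ v, (nb G.Adj v).card ≤ Δ) (v x : V) (hvx : G.Adj v x)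
    (hv : (nb G.Adj v).card = 2) (hx : (nb G.Adj x).card = 2)
    (ih : HasGood (del G {v}) (2 * Δ + 2)) : HasGood G (2 * Δ + 2) := by
  obtain ⟨c, O, hpc, ht⟩ := ih
  have h := hpc.ofDel
  have hO : O v = ∅ := by
    rw [Finset.eq_empty_iff_forall_notMem]
    intro u hu
    exact (h.osub _ _ hu).2.1 rfl
  have hxO : ∀ u, v ∉ O u := fun u hu => (h.osub _ _ hu).2.2 rfl
  obtain ⟨w, hwx, hvw, hnb⟩ := nb_pair hvx hv
  have hdel : ∀ u, G.Adj v u → (nb (del G {v}).Adj u).card + 1 ≤ (nb G.Adj u).card := by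
    intro u hu
    have := card_nb_del G {v} u {v} (by
      intro d hd
      rw [Finset.mem_singleton] at hd
      subst hd
      exact mem_nb.2 hu.symm) (by simp)
    rwa [Finset.card_singleton] at this
  have hdx := hdel x hvx
  have hdw := hdel w hvw
  have hbw := hub w
  have hn : ∀ u, ¬ (del G {v}).Adj v u := fun u h => h.2.1 rfl
  have hav1 := card_av h ht hvw (fun z w' hz hw => ⟨hz, hvw.ne.symm, (h.osub _ _ hw).2.1⟩)
  have hav2 := card_av h ht hvx (fun z w' hz hw => ⟨hz, hvx.ne.symm, (h.osub _ _ hw).2.1⟩)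
  rw [hnb, Finset.sum_pair hwx.symm] at hav1 hav2
  obtain ⟨α, hα⟩ : (av G (del G {v}).Adj c O (2 * Δ + 2) v w).Nonempty :=
    Finset.card_pos.1 (by omega)
  obtain ⟨β, hβ, hβα⟩ : ∃ β ∈ av G (del G {v}).Adj c O (2 * Δ + 2) v x, β ∉ ({α} : Finset ℕ) :=
    Finset.exists_mem_notMem_of_card_lt_card (by rw [Finset.card_singleton]; omega)
  rw [Finset.mem_singleton] at hβα
  rw [mem_av] at hα hβ
  have hp1 := h.add hvw (hn w) hα.1 hα.2
  have hok := OKc.update h (α := α) (hn w) hβ.2 (Or.inl (Ne.symm hβα))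
  have hn2 : ¬ addF (del G {v}).Adj v w v x := by
    rintro (h1 | h1 | h1)
    · exact hn _ h1
    · exact hwx h1.2.symm
    · exact hvw.ne h1.1
  have hOx : (O x).card ≤ 1 := by
    have : O x ⊆ nb (del G {v}).Adj x := fun u hu => mem_nb.2 (h.osub _ _ hu)
    have := Finset.card_le_card this
    omega
  refine ⟨_, _, (hp1.add hvx hn2 hβ.1 hok).congr ?_,
    ht.add_two hO hxO hvw.ne hvx.ne hOx⟩
  intro a b
  constructor
  · rintro ((h1 | ⟨rfl, rfl⟩ | ⟨rfl, rfl⟩) | ⟨rfl, rfl⟩ | ⟨rfl, rfl⟩)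
    · exact h1.1
    · exact hvw
    · exact hvw.symm
    · exact hvx
    · exact hvx.symm
  · intro hab
    have hnx : ∀ u, G.Adj v u → u = x ∨ u = w := by
      intro u hu
      have : u ∈ nb G.Adj v := mem_nb.2 hu
      rwa [hnb, Finset.mem_insert, Finset.mem_singleton] at this
    unfold addF
    by_cases ha : a = v
    · subst ha
      have := hnx _ hab
      tauto
    · by_cases hb : b = v
      · subst hb
        have := hnx _ hab.symm
        tauto
      · exact Or.inl (Or.inl ⟨hab, ha, hb⟩)

theorem reduce_three {V : Type*} [Fintype V] (G : SimpleGraph V) (Δ : ℕ)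
    (hub : ∀ v, (nb G.Adj v).card ≤ Δ) (v x1 x2 : V) (hne : x1 ≠ x2) (hv1 : G.Adj v x1)
    (hv2 : G.Adj v x2) (hv : (nb G.Adj v).card = 3) (hx1 : (nb G.Adj x1).card = 2)
    (hx2 : (nb G.Adj x2).card = 2) (hna : ¬ G.Adj x1 x2)
    (ih : HasGood (del G {x1, x2}) (2 * Δ + 2)) : HasGood G (2 * Δ + 2) := by
  obtain ⟨c, O, hpc, ht⟩ := ih
  have h := hpc.ofDel
  have hΔ : 3 ≤ Δ := hv ▸ hub v
  have hD1 : x1 ∈ ({x1, x2} : Set V) := by simp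
  have hD2 : x2 ∈ ({x1, x2} : Set V) := by simp
  have hO : ∀ d ∈ ({x1, x2} : Set V), O d = ∅ := by
    intro d hd
    rw [Finset.eq_empty_iff_forall_notMem]
    intro u hu
    exact (h.osub _ _ hu).2.1 hd
  have hxO : ∀ d ∈ ({x1, x2} : Set V), ∀ u, d ∉ O u := fun d hd u hu => (h.osub _ _ hu).2.2 hd
  obtain ⟨w1, hw1v, hxw1, hnb1⟩ := nb_pair hv1.symm hx1
  obtain ⟨w2, hw2v, hxw2, hnb2⟩ := nb_pair hv2.symm hx2
  have hN1 : ∀ u, G.Adj x1 u → u = v ∨ u = w1 := by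
    intro u hu
    have : u ∈ nb G.Adj x1 := mem_nb.2 hu
    rwa [hnb1, Finset.mem_insert, Finset.mem_singleton] at this
  have hN2 : ∀ u, G.Adj x2 u → u = v ∨ u = w2 := by
    intro u hu
    have : u ∈ nb G.Adj x2 := mem_nb.2 hu
    rwa [hnb2, Finset.mem_insert, Finset.mem_singleton] at this
  have hw1x2 : w1 ≠ x2 := fun e => hna (e ▸ hxw1)
  have hw2x1 : w2 ≠ x1 := fun e => hna (e ▸ hxw2).symm
  have hvD : v ∉ ({x1, x2} : Set V) := by
    rintro (rfl | rfl)
    · exact hv1.ne rfl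
    · exact hv2.ne rfl
  have hw1D : w1 ∉ ({x1, x2} : Set V) := by
    rintro (e | e)
    · exact hxw1.ne e.symm
    · exact hw1x2 e
  have hw2D : w2 ∉ ({x1, x2} : Set V) := by
    rintro (e | e)
    · exact hw2x1 e
    · exact hxw2.ne e.symm
  have hdel1 : ∀ d ∈ ({x1, x2} : Set V), ∀ u, G.Adj d u →
      (nb (del G {x1, x2}).Adj u).card + 1 ≤ (nb G.Adj u).card := by
    intro d hd u hu
    have := card_nb_del G {x1, x2} u {d} (by
      intro e he
      rw [Finset.mem_singleton] at he
      subst he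
      exact mem_nb.2 hu.symm) (by
      intro e he
      rw [Finset.mem_singleton] at he
      rwa [he])
    rwa [Finset.card_singleton] at this
  have hdel2 : ∀ u, G.Adj x1 u → G.Adj x2 u →
      (nb (del G {x1, x2}).Adj u).card + 2 ≤ (nb G.Adj u).card := by
    intro u hu hu'
    have := card_nb_del G {x1, x2} u {x1, x2} (by
      intro e he
      rw [Finset.mem_insert, Finset.mem_singleton] at he
      rcases he with rfl | rfl
      · exact mem_nb.2 hu.symm
      · exact mem_nb.2 hu'.symm) (by
      intro e he
      rw [Finset.mem_insert, Finset.mem_singleton] at he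
      exact he)
    rwa [Finset.card_pair hne] at this
  have hdv := hdel2 v hv1.symm hv2.symm
  have hdw1 := hdel1 x1 hD1 w1 hxw1
  have hdw2 := hdel1 x2 hD2 w2 hxw2
  have hbw1 := hub w1
  have hbw2 := hub w2
  have hav1 := card_av h ht hxw1 (fun z w' hz hw => ⟨hz, hw1D, (h.osub _ _ hw).2.1⟩)
  have hav2 := card_av h ht hxw2 (fun z w' hz hw => ⟨hz, hw2D, (h.osub _ _ hw).2.1⟩)
  have hav3 := card_av h ht hv1.symm (fun z w' hz hw => ⟨hz, hvD, (h.osub _ _ hw).2.1⟩)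
  have hav4 := card_av h ht hv2.symm (fun z w' hz hw => ⟨hz, hvD, (h.osub _ _ hw).2.1⟩)
  rw [hnb1, Finset.sum_pair hw1v.symm] at hav1 hav3
  rw [hnb2, Finset.sum_pair hw2v.symm] at hav2 hav4
  set F := (del G {x1, x2}).Adj with hF
  set K := 2 * Δ + 2 with hK
  -- the choice of the four colours
  obtain ⟨a, ha, b, hb, e, he, f, hf, hae, haf, hbe, hbf, hef, hab⟩ :
      ∃ a ∈ av G F c O K x1 w1, ∃ b ∈ av G F c O K x2 w2, ∃ e ∈ av G F c O K x1 v,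
        ∃ f ∈ av G F c O K x2 v,
        a ≠ e ∧ a ≠ f ∧ b ≠ e ∧ b ≠ f ∧ e ≠ f ∧ (a ≠ b ∨ w1 ≠ w2) := by
    by_cases hw : w1 = w2
    · have hdw := hdel2 w1 hxw1 (hw ▸ hxw2)
      subst hw
      obtain ⟨a, ha, b, hb, e, he, f, hf, h1, h2, h3, h4, h5, h6⟩ :=
        pick_four' (av G F c O K x1 w1) (av G F c O K x2 w1) (av G F c O K x1 v)
          (av G F c O K x2 v) (by omega) (by omega) (by omega) (by omega)
      exact ⟨a, ha, b, hb, e, he, f, hf, h1, h2, h3, h4, h5, Or.inl h6⟩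
    · obtain ⟨a, ha, b, hb, e, he, f, hf, h1, h2, h3, h4, h5⟩ :=
        pick_four (av G F c O K x1 w1) (av G F c O K x2 w2) (av G F c O K x1 v)
          (av G F c O K x2 v) (by omega) (by omega) (by omega) (by omega)
      exact ⟨a, ha, b, hb, e, he, f, hf, h1, h2, h3, h4, h5, Or.inr hw⟩
  rw [mem_av] at ha hb he hf
  have hn1 : ∀ u, ¬ F x1 u := fun u h => h.2.1 hD1
  have hn2 : ∀ u, ¬ F x2 u := fun u h => h.2.1 hD2
  have hvx1 := hv1.ne
  have hvx2 := hv2.ne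
  have hx1w1 := hxw1.ne
  have hx2w2 := hxw2.ne
  -- first edge
  have hp1 := h.add hxw1 (hn1 w1) ha.1 ha.2
  have okb1 := OKc.update h (α := a) (hn1 w1) hb.2 (by
    rcases hab with h1 | h1
    · exact Or.inl h1
    · refine Or.inr ⟨fun h => hna h.symm, ?_, ?_⟩
      · intro h2
        rcases hN2 _ h2 with h3 | h3
        · exact hw1v h3
        · exact h1 h3
      · intro h2
        rcases hN1 _ h2.symm with h3 | h3
        · exact hw2v h3
        · exact h1 h3.symm)
  have oke1 := OKc.update h (α := a) (hn1 w1) he.2 (Or.inl hae)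
  have okf1 := OKc.update h (α := a) (hn1 w1) hf.2 (Or.inl haf)
  -- second edge
  have hm2 : ¬ addF F x1 w1 x2 w2 := by
    rintro (h1 | h1 | h1)
    · exact hn2 _ h1
    · exact hne h1.1.symm
    · exact hw1x2 h1.1.symm
  have hp2 := hp1.add hxw2 hm2 hb.1 okb1
  have oke2 := OKc.update hp1 (α := b) hm2 oke1 (Or.inl hbe)
  have okf2 := OKc.update hp1 (α := b) hm2 okf1 (Or.inl hbf)
  -- third edge
  have hm3 : ¬ addF (addF F x1 w1) x2 w2 x1 v := by
    rintro ((h1 | h1 | h1) | h1 | h1)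
    · exact hn1 _ h1
    · exact hw1v h1.2.symm
    · exact hx1w1 h1.1
    · exact hne h1.1
    · exact hw2x1 h1.1.symm
  have hp3 := hp2.add hv1.symm hm3 he.1 oke2
  have okf3 := OKc.update hp2 (α := e) hm3 okf2 (Or.inl hef)
  -- fourth edge
  have hm4 : ¬ addF (addF (addF F x1 w1) x2 w2) x1 v x2 v := by
    rintro (((h1 | h1 | h1) | h1 | h1) | h1 | h1)
    · exact hn2 _ h1
    · exact hne h1.1.symm
    · exact hw1x2 h1.1.symm
    · exact hw2v h1.2.symm
    · exact hx2w2 h1.1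
    · exact hne h1.1.symm
    · exact hvx2 h1.1.symm
  have hp4 := hp3.add hv2.symm hm4 hf.1 okf3
  have hOv : (O v).card ≤ 1 := by
    have : O v ⊆ nb F v := fun u hu => mem_nb.2 (h.osub _ _ hu)
    have := Finset.card_le_card this
    omega
  have ht1 := ht.add_two (y := w1) (z := v) (hO x1 hD1) (hxO x1 hD1) hx1w1 hvx1.symm hOv
  have ht2 := ht1.add_two (x := x2) (y := w2) (z := v)
    (by simp [addO, hne.symm, hO x2 hD2])
    (by
      intro u hu
      rcases mem_addO.1 hu with h1 | h1
      · rcases mem_addO.1 h1 with h2 | h2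
        · exact hxO x2 hD2 u h2
        · exact hw1x2 h2.2.symm
      · exact hvx2 h1.2.symm) hx2w2 hvx2.symm
    (by simpa [addO, hvx1] using hOv)
  rw [addO_comm (addO O x1 w1) x1 v x2 w2] at ht2
  refine ⟨_, _, hp4.congr ?_, ht2⟩
  intro p q
  constructor
  · rintro ((((h1 | ⟨rfl, rfl⟩ | ⟨rfl, rfl⟩) | ⟨rfl, rfl⟩ | ⟨rfl, rfl⟩) | ⟨rfl, rfl⟩ | ⟨rfl, rfl⟩) |
      ⟨rfl, rfl⟩ | ⟨rfl, rfl⟩)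
    · exact h1.1
    · exact hxw1
    · exact hxw1.symm
    · exact hxw2
    · exact hxw2.symm
    · exact hv1.symm
    · exact hv1
    · exact hv2.symm
    · exact hv2
  · intro hpq
    unfold addF
    by_cases hp1 : p = x1
    · have := hN1 q (hp1 ▸ hpq)
      clear * - this hp1
      tauto
    by_cases hp2 : p = x2
    · have := hN2 q (hp2 ▸ hpq)
      clear * - this hp2
      tauto
    by_cases hq1 : q = x1
    · have := hN1 p (hq1 ▸ hpq.symm)
      clear * - this hq1
      tauto
    by_cases hq2 : q = x2
    · have := hN2 p (hq2 ▸ hpq.symm)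
      clear * - this hq2
      tauto
    refine Or.inl (Or.inl (Or.inl (Or.inl ⟨hpq, ?_, ?_⟩)))
    · rintro (h1 | h1)
      · exact hp1 h1
      · exact hp2 h1
    · rintro (h1 | h1)
      · exact hq1 h1
      · exact hq2 h1

theorem hasGood_of_sparse {V : Type*} [Fintype V] (Δ : ℕ) (hΔ : 2 ≤ Δ) :
    ∀ (n : ℕ) (G : SimpleGraph V), ∑ u, (nb G.Adj u).card = n →
      (∀ v, (nb G.Adj v).card ≤ Δ) → Sparse G → HasGood G (2 * Δ + 2) := by
  intro n
  induction n using Nat.strong_induction_on with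
  | _ n ih =>
    intro G hn hub hsp
    have step : ∀ (D : Set V) (v w : V), v ∈ D → G.Adj v w →
        HasGood (del G D) (2 * Δ + 2) := by
      intro D v w hv hw
      exact ih _ (hn ▸ measure_del G D hv hw) (del G D) rfl
        (fun u => (Finset.card_le_card (nb_del_sub G D u)).trans (hub u)) (hsp.del D)
    by_cases hne : ∃ a b, G.Adj a b
    · rcases unavoidable G hsp hne with ⟨x, hx⟩ | ⟨v, x, hvx, hv, hx⟩ |
        ⟨v, x1, x2, hne, h1, h2, hv, hx1, hx2, hna⟩
      · obtain ⟨y, hy⟩ : (nb G.Adj x).Nonempty := Finset.card_pos.1 (by omega)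
        exact reduce_leaf G Δ hub x hx (step {x} x y rfl (mem_nb.1 hy))
      · exact reduce_two G Δ hΔ hub v x hvx hv hx (step {v} v x rfl hvx)
      · exact reduce_three G Δ hub v x1 x2 hne h1 h2 hv hx1 hx2 hna
          (step {x1, x2} x1 v (by simp) h1.symm)
    · push Not at hne
      refine ⟨fun _ _ => 0, fun _ => ∅, ?_, ?_⟩
      · constructor
        · exact fun a b h => h.symm
        · exact fun a b h => h
        · exact fun _ _ => rfl
        · exact fun a b h => absurd h (hne a b)
        · intro a b h
          simp at h
        · exact fun a b h => absurd h (hne a b)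
        · intro x y z w h
          simp at h
      · constructor
        · simp
        · simp

theorem Sparse.ofMad {V : Type*} [Fintype V] {G : SimpleGraph V} (h : MadLT G (8 / 3)) :
    Sparse G := by
  intro S hS
  have h1 := h (S : Set V) S.finite_toSet hS
  set H : SimpleGraph V := SSE.del G (S : Set V)ᶜ with hH
  have hE : {e ∈ G.edgeSet | ∀ v ∈ e, v ∈ (S : Set V)} = H.edgeSet := by
    ext e
    induction e using Sym2.ind with
    | _ a b => simp [hH, SSE.del]
  have hcard : H.edgeSet.ncard = H.edgeFinset.card := by
    rw [Set.ncard_eq_toFinset_card']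
    rfl
  have hdeg : ∑ v ∈ S, (nb G.Adj v ∩ S).card = ∑ v, H.degree v := by
    rw [← Finset.sum_subset (Finset.subset_univ S)]
    · apply Finset.sum_congr rfl
      intro v hv
      rw [← SimpleGraph.card_neighborFinset_eq_degree]
      congr 1
      ext w
      simp [mem_nb, hH, SSE.del, hv]
    · intro v _ hv
      rw [← SimpleGraph.card_neighborFinset_eq_degree, Finset.card_eq_zero]
      ext w
      simp [hH, SSE.del, hv]
  rw [hE, hcard, Set.ncard_coe_finset] at h1
  rw [hdeg, SimpleGraph.sum_degrees_eq_twice_card_edges]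
  have h2 : (3 * (2 * (H.edgeFinset.card : ℚ))) < 8 * S.card := by linarith
  exact_mod_cast h2

theorem PC.isPColoring {V : Type*} {G : SimpleGraph V} {c : V → V → ℕ}
    {O : V → Finset V} {K : ℕ} (h : PC G G.Adj c O K) :
    IsPColoring G IsSemistrongMatching (Sym2.lift ⟨c, h.csym⟩) K := by
  -- every edge has a tail
  have htail : ∀ e ∈ G.edgeSet, ∃ x y, e = s(x, y) ∧ y ∈ O x := by
    intro e he
    induction e using Sym2.ind with
    | _ a b =>
      rcases h.cover a b he with h1 | h1
      · exact ⟨a, b, rfl, h1⟩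
      · exact ⟨b, a, Sym2.eq_swap, h1⟩
  refine ⟨?_, ?_⟩
  · intro e he
    induction e using Sym2.ind with
    | _ a b => exact h.lt a b he
  · intro i
    have hkey : ∀ x y z w, y ∈ O x → c x y = i → G.Adj x z → G.Adj z w → c z w = i →
        z = y ∧ w = x := by
      intro x y z w h1 h2 h3 h4 h5
      by_contra hcon
      exact h.valid x y z w h1 h3 h4 hcon (h5.trans h2.symm)
    refine ⟨⟨fun e he => he.1, ?_⟩, ?_⟩
    · rintro e ⟨he, hei⟩ f ⟨hf, hfi⟩ hef v hve hvf
      obtain ⟨x, y, rfl, hxy⟩ := htail e he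
      obtain ⟨u, rfl⟩ := Sym2.mem_iff_exists.1 hvf
      rw [Sym2.mem_iff] at hve
      simp only [Sym2.lift_mk] at hei hfi
      rcases hve with rfl | rfl
      · have := hkey v y u v hxy hei hf (G.adj_symm hf) (by rw [h.csym]; exact hfi)
        exact hef (by rw [this.1])
      · have := hkey x v v u hxy hei he hf hfi
        exact hef (by rw [this.2, Sym2.eq_swap])
    · rintro e ⟨he, hei⟩
      obtain ⟨x, y, rfl, hxy⟩ := htail e he
      simp only [Sym2.lift_mk] at hei
      refine ⟨x, Sym2.mem_mk_left x y, ⟨s(x, y), ⟨he, hei⟩, Sym2.mem_mk_left x y⟩, y,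
        ⟨⟨s(x, y), ⟨he, hei⟩, Sym2.mem_mk_right x y⟩, he⟩, ?_⟩
      rintro u ⟨⟨f, ⟨hf, hfi⟩, huf⟩, hxu⟩
      obtain ⟨w, rfl⟩ := Sym2.mem_iff_exists.1 huf
      simp only [Sym2.lift_mk] at hfi
      exact (hkey x y u w hxy hei hxu hf hfi).1

end Aux

/-- If `G` has maximum degree `Δ ≥ 2` and maximum average degree `< 8/3`, then
`χ'_ss(G) ≤ 2Δ + 2`. -/
theorem ssIndex_le_of_mad_lt_eight_thirds {V : Type*} [Fintype V] (G : SimpleGraph V)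
    (Δ : ℕ) (hΔ : 2 ≤ Δ) (hub : ∀ v, natDeg G v ≤ Δ) (hex : ∃ v, natDeg G v = Δ)
    (hmad : MadLT G (8 / 3)) :
    ssIndex G ≤ 2 * Δ + 2 := by
  have hub' : ∀ v, (nb G.Adj v).card ≤ Δ := by
    intro v
    refine le_trans (le_of_eq ?_) (hub v)
    unfold natDeg
    rw [← Set.ncard_coe_finset]
    congr 1
    ext w
    simp [mem_nb]
  obtain ⟨c, O, hpc, _⟩ := hasGood_of_sparse Δ hΔ _ G rfl hub' (Sparse.ofMad hmad)
  exact Nat.sInf_le ⟨_, hpc.isPColoring⟩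

end SSE
end
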